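/- Under the gap condition, take φ := u₁ in the conformal deformation g_t = e^{tφ}g_Γ. Then, as t → 0, λ₁(t) = λ₁ + (λ₁·(n² − 5n + 1)/(12·D))·t² + o(t²). -/

import Mathlib

open MeasureTheory Real Filter Topology Asymptotics
open scoped InnerProductSpace

noncomputable section

/-- Euclidean space `ℝⁿ`. -/
abbrev E (n : ℕ) := EuclideanSpace ℝ (Fin n)

/-- The vector `A·t ∈ ℝⁿ`. -/
def matVec {n : ℕ} (A : Matrix (Fin n) (Fin n) ℝ) (t : Fin n → ℝ) : E n :=
  (WithLp.equiv 2 (Fin n → ℝ)).symm (A.mulVec t)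

/-- The lattice `Γ = A·ℤⁿ`. -/
def lattice {n : ℕ} (A : Matrix (Fin n) (Fin n) ℝ) : Set (E n) :=
  {x | ∃ m : Fin n → ℤ, x = matVec A fun i => (m i : ℝ)}

/-- The dual lattice `Γ* = {w : ⟨w,x⟩ ∈ ℤ for all x ∈ Γ}`. -/
def dualLattice {n : ℕ} (Γ : Set (E n)) : Set (E n) :=
  {w | ∀ x ∈ Γ, ∃ k : ℤ, ⟪w, x⟫_ℝ = (k : ℝ)}

/-- `f` is `Γ`-periodic. -/
def IsPeriodic {n : ℕ} (Γ : Set (E n)) (f : E n → ℝ) : Prop :=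
  ∀ x : E n, ∀ γ ∈ Γ, f (x + γ) = f x

/-- The fundamental domain `F = A·[0,1)ⁿ`. -/
def fundDomain {n : ℕ} (A : Matrix (Fin n) (Fin n) ℝ) : Set (E n) :=
  {x | ∃ t : Fin n → ℝ, (∀ i, t i ∈ Set.Ico (0:ℝ) 1) ∧ x = matVec A t}

/-- Geometer's (nonnegative) Laplacian: `Δ f = -∑ᵢ ∂²f/∂xᵢ²`. -/
def lap {n : ℕ} (f : E n → ℝ) (x : E n) : ℝ :=
  -∑ i : Fin n, iteratedFDeriv ℝ 2 f x ![EuclideanSpace.single i 1, EuclideanSpace.single i 1]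

/-- The gap condition: `w ∈ Γ* \ {0}` and `|w| < |v|` for every `v ∈ Γ* \ {0, w, -w}`. -/
def GapCondition {n : ℕ} (Γ : Set (E n)) (w : E n) : Prop :=
  w ∈ dualLattice Γ ∧ w ≠ 0 ∧
    ∀ v ∈ dualLattice Γ, v ≠ 0 → v ≠ w → v ≠ -w → ‖w‖ < ‖v‖

/-- `u₁(x) = √2·D^{-1/2}·sin(2π⟨w,x⟩)` where `D = |det A|`. -/
def uSin {n : ℕ} (A : Matrix (Fin n) (Fin n) ℝ) (w : E n) : E n → ℝ :=
  fun x => Real.sqrt 2 / Real.sqrt |A.det| * Real.sin (2 * π * ⟪w, x⟫_ℝ)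

/-- `u₂(x) = √2·D^{-1/2}·cos(2π⟨w,x⟩)` where `D = |det A|`. -/
def uCos {n : ℕ} (A : Matrix (Fin n) (Fin n) ℝ) (w : E n) : E n → ℝ :=
  fun x => Real.sqrt 2 / Real.sqrt |A.det| * Real.cos (2 * π * ⟪w, x⟫_ℝ)

/-- The volume `V_φ(t) = ∫_F e^{ntφ/2} dx` of the conformal metric `e^{tφ}g_Γ`. -/
def confVol {n : ℕ} (A : Matrix (Fin n) (Fin n) ℝ) (φ : E n → ℝ) (t : ℝ) : ℝ :=
  ∫ x in fundDomain A, Real.exp ((n : ℝ) * t * φ x / 2)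

/-- The first positive Laplace eigenvalue `λ₁(t)` of the conformal metric `e^{tφ}g_Γ`,
as the infimum of the Rayleigh quotient over smooth `Γ`-periodic functions that are
not identically zero and have zero mean with respect to the conformal volume measure. -/
def confLam1 {n : ℕ} (A : Matrix (Fin n) (Fin n) ℝ) (φ : E n → ℝ) (t : ℝ) : ℝ :=
  sInf {r : ℝ | ∃ f : E n → ℝ, ContDiff ℝ (⊤ : ℕ∞) f ∧ IsPeriodic (lattice A) f ∧ f ≠ 0 ∧
    (∫ x in fundDomain A, f x * Real.exp ((n : ℝ) * t * φ x / 2)) = 0 ∧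
    r = (∫ x in fundDomain A, ‖gradient f x‖ ^ 2 * Real.exp (((n : ℝ) - 2) * t * φ x / 2)) /
        (∫ x in fundDomain A, (f x) ^ 2 * Real.exp ((n : ℝ) * t * φ x / 2))}

/-- `UnitAddCircle` carries its Haar probability measure, as in the theory of multiple Fourier
series. -/
local instance : MeasureSpace UnitAddCircle := ⟨AddCircle.haarAddCircle⟩

local instance : Measure.IsAddHaarMeasure (volume : Measure UnitAddCircle) :=
  inferInstanceAs (Measure.IsAddHaarMeasure AddCircle.haarAddCircle)

local instance : IsProbabilityMeasure (volume : Measure UnitAddCircle) :=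
  inferInstanceAs (IsProbabilityMeasure AddCircle.haarAddCircle)

section Torus

variable {n : ℕ} {A : Matrix (Fin n) (Fin n) ℝ} {X : Type*}

/-- Periodicity with respect to the lattice `A·ℤⁿ`, for functions with arbitrary values. -/
def LatticePeriodic (A : Matrix (Fin n) (Fin n) ℝ) (h : E n → X) : Prop :=
  ∀ x, ∀ γ ∈ lattice A, h (x + γ) = h x

/-- The function on the standard torus induced by a periodic function on `ℝⁿ`. -/
def torusLift (A : Matrix (Fin n) (Fin n) ℝ) (h : E n → X) (t : UnitAddTorus (Fin n)) : X :=
  h (matVec A fun i => Quotient.out (t i))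

lemma matVec_add (y z : Fin n → ℝ) : matVec A (y + z) = matVec A y + matVec A z := by
  simp [matVec, Matrix.mulVec_add]

lemma continuous_matVec : Continuous (matVec A) := by
  unfold matVec
  exact (PiLp.continuous_toLp 2 _).comp (Continuous.matrix_mulVec continuous_const continuous_id)

lemma matVec_inv (hA : IsUnit A.det) (x : E n) : matVec A (A⁻¹.mulVec x.ofLp) = x := by
  simp [matVec, Matrix.mulVec_mulVec, Matrix.mul_nonsing_inv _ hA]

lemma LatticePeriodic.torusLift_apply {h : E n → X} (hper : LatticePeriodic A h)
    (y : Fin n → ℝ) :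
    torusLift A h (fun i => (y i : UnitAddCircle)) = h (matVec A y) := by
  have hk : ∀ i, ∃ k : ℤ, Quotient.out (y i : UnitAddCircle) = y i + k := by
    intro i
    have h1 : ((Quotient.out (y i : UnitAddCircle) : ℝ) : UnitAddCircle) = (y i : UnitAddCircle) :=
      Quotient.out_eq _
    rw [← sub_eq_zero, ← AddCircle.coe_sub, AddCircle.coe_eq_zero_iff] at h1
    obtain ⟨k, hk⟩ := h1
    refine ⟨k, ?_⟩
    rw [zsmul_one] at hk
    linarith
  choose k hk using hk
  have : (fun i => Quotient.out (y i : UnitAddCircle)) = y + fun i => (k i : ℝ) := funext hk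
  rw [torusLift, this, matVec_add]
  exact hper _ _ ⟨k, rfl⟩

lemma isOpenQuotientMap_torusMk :
    IsOpenQuotientMap (fun (y : Fin n → ℝ) (i : Fin n) => (y i : UnitAddCircle)) :=
  IsOpenQuotientMap.piMap fun _ => QuotientAddGroup.isOpenQuotientMap_mk

lemma LatticePeriodic.continuous_torusLift [TopologicalSpace X] {h : E n → X}
    (hper : LatticePeriodic A h) (hc : Continuous h) : Continuous (torusLift A h) := by
  rw [isOpenQuotientMap_torusMk.isQuotientMap.continuous_iff]
  have : torusLift A h ∘ (fun (y : Fin n → ℝ) (i : Fin n) => (y i : UnitAddCircle)) =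
      h ∘ matVec A := funext fun y => hper.torusLift_apply y
  rw [this]
  exact hc.comp continuous_matVec

lemma fundDomain_eq_image :
    fundDomain A = Set.image (matVec A) (Set.pi Set.univ fun _ => Set.Ico (0:ℝ) 1) := by
  ext x
  simp [fundDomain, Set.mem_pi, eq_comm]

lemma measurableEmbedding_matVec (hA : IsUnit A.det) : MeasurableEmbedding (matVec A) := by
  refine continuous_matVec.measurableEmbedding ?_
  intro y z hyz
  have := (WithLp.equiv 2 (Fin n → ℝ)).symm.injective hyz
  exact Matrix.mulVec_injective_iff_isUnit.2 ((Matrix.isUnit_iff_isUnit_det _).2 hA) this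

lemma map_matVec_volume (hA : IsUnit A.det) :
    Measure.map (matVec A) volume = ENNReal.ofReal |A.det|⁻¹ • (volume : Measure (E n)) := by
  have h1 := Real.map_matrix_volume_pi_eq_smul_volume_pi hA.ne_zero
  have h2 : matVec A = WithLp.toLp 2 ∘ Matrix.toLin' A := rfl
  rw [h2, ← Measure.map_map (WithLp.measurable_toLp 2 _)
    (Matrix.toLin' A).continuous_of_finiteDimensional.measurable, h1, Measure.map_smul,
    (PiLp.volume_preserving_toLp (Fin n)).map_eq, abs_inv]

lemma LatticePeriodic.setIntegral_fundDomain [NormedAddCommGroup X] [NormedSpace ℝ X]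
    (hA : IsUnit A.det) {h : E n → X} (hper : LatticePeriodic A h) :
    ∫ x in fundDomain A, h x = |A.det| • ∫ t, torusLift A h t := by
  have hD : 0 < |A.det| := abs_pos.2 hA.ne_zero
  have h1 : (volume : Measure (E n)) = ENNReal.ofReal |A.det| • Measure.map (matVec A) volume := by
    rw [map_matVec_volume hA, smul_smul, ← ENNReal.ofReal_mul hD.le, mul_inv_cancel₀ hD.ne']
    simp
  rw [UnitAddTorus.integral_preimage _ 0, h1, Measure.restrict_smul, integral_smul_measure,
    ENNReal.toReal_ofReal hD.le, (measurableEmbedding_matVec hA).setIntegral_map,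
    fundDomain_eq_image, Set.preimage_image_eq _ (measurableEmbedding_matVec hA).injective]
  congr 1
  have h2 : (Set.pi Set.univ fun _ : Fin n => Set.Ico (0:ℝ) 1) =ᵐ[volume]
      {x : Fin n → ℝ | ∀ i, x i ∈ Set.Ioc ((0 : Fin n → ℝ) i) ((0 : Fin n → ℝ) i + 1)} := by
    have h3 : {x : Fin n → ℝ | ∀ i, x i ∈ Set.Ioc ((0 : Fin n → ℝ) i) ((0 : Fin n → ℝ) i + 1)} =
        Set.pi Set.univ fun _ => Set.Ioc (0:ℝ) 1 := by
      ext; simp [Set.mem_pi]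
    rw [h3]
    exact (Measure.univ_pi_Ico_ae_eq_Icc (f := fun _ => 0) (g := fun _ => 1)).trans
      (Measure.univ_pi_Ioc_ae_eq_Icc (f := fun _ => 0) (g := fun _ => 1)).symm
  rw [setIntegral_congr_set h2]
  simp_rw [hper.torusLift_apply]

lemma LatticePeriodic.setIntegral_add_right [NormedAddCommGroup X] [NormedSpace ℝ X]
    (hA : IsUnit A.det) {h : E n → X} (hper : LatticePeriodic A h) (v : E n) :
    ∫ x in fundDomain A, h (x + v) = ∫ x in fundDomain A, h x := by
  have hper' : LatticePeriodic A fun x => h (x + v) := by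
    intro x γ hγ
    simp only
    rw [add_right_comm, hper _ _ hγ]
  rw [hper.setIntegral_fundDomain hA, hper'.setIntegral_fundDomain hA]
  congr 1
  rw [← integral_add_right_eq_self (torusLift A h)
    (fun i => ((A⁻¹.mulVec v.ofLp i : ℝ) : UnitAddCircle))]
  congr 1
  ext t
  obtain ⟨y, rfl⟩ := isOpenQuotientMap_torusMk.surjective t
  rw [hper'.torusLift_apply]
  have := hper.torusLift_apply (y + A⁻¹.mulVec v.ofLp)
  rw [matVec_add, matVec_inv hA] at this
  exact this.symm

lemma isBounded_fundDomain : Bornology.IsBounded (fundDomain A) := by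
  rw [fundDomain_eq_image]
  refine ((isCompact_univ_pi fun _ => isCompact_Icc (a := (0:ℝ)) (b := 1)).image
    continuous_matVec).isBounded.subset (Set.image_mono ?_)
  exact Set.pi_mono fun _ _ => Set.Ico_subset_Icc_self

lemma integrableOn_fundDomain [NormedAddCommGroup X] {h : E n → X} (hc : Continuous h) :
    IntegrableOn h (fundDomain A) :=
  (hc.continuousOn.integrableOn_compact isBounded_fundDomain.isCompact_closure).mono_set
    subset_closure

lemma latticePeriodic_fderiv [NormedAddCommGroup X] [NormedSpace ℝ X] {h : E n → X}
    (hper : LatticePeriodic A h) : LatticePeriodic A (fderiv ℝ h) := by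
  intro x γ hγ
  rw [← fderiv_comp_add_right]
  congr 1
  exact funext fun y => hper y γ hγ

/-- The integral of a directional derivative of a periodic function vanishes. -/
lemma LatticePeriodic.setIntegral_fderiv [NormedAddCommGroup X] [NormedSpace ℝ X]
    (hA : IsUnit A.det) {h : E n → X} (hper : LatticePeriodic A h)
    (hc : ContDiff ℝ 1 h) (v : E n) :
    ∫ x in fundDomain A, fderiv ℝ h x v = 0 := by
  have hcd : Continuous (fderiv ℝ h) := hc.continuous_fderiv one_ne_zero
  obtain ⟨C, hC⟩ : ∃ C, ∀ x, ‖fderiv ℝ h x‖ ≤ C := by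
    have hcomp := isCompact_range ((latticePeriodic_fderiv hper).continuous_torusLift hcd)
    obtain ⟨C, hC⟩ := hcomp.isBounded.exists_norm_le
    refine ⟨C, fun x => ?_⟩
    rw [← matVec_inv hA x, ← (latticePeriodic_fderiv hper).torusLift_apply]
    exact hC _ ⟨_, rfl⟩
  have key := hasDerivAt_integral_of_dominated_loc_of_deriv_le
    (μ := volume.restrict (fundDomain A)) (x₀ := (0:ℝ)) (s := Set.univ) (bound := fun _ => C * ‖v‖)
    (F := fun τ x => h (x + τ • v)) (F' := fun τ x => fderiv ℝ h (x + τ • v) v) Filter.univ_mem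
    (Eventually.of_forall fun τ => (hc.continuous.comp (by fun_prop)).aestronglyMeasurable)
    (integrableOn_fundDomain (hc.continuous.comp (by fun_prop)))
    ((hcd.comp (by fun_prop)).clm_apply continuous_const).aestronglyMeasurable
    (Eventually.of_forall fun x τ _ => (ContinuousLinearMap.le_opNorm _ _).trans
      (mul_le_mul_of_nonneg_right (hC _) (norm_nonneg _)))
    (integrableOn_fundDomain continuous_const)
    (Eventually.of_forall fun x τ _ => by
      have h1 : HasDerivAt (fun τ : ℝ => x + τ • v) v τ := by
        simpa using ((hasDerivAt_id τ).smul_const v).const_add x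
      exact ((hc.differentiable one_ne_zero).differentiableAt.hasFDerivAt).comp_hasDerivAt τ h1)
  have h2 : (fun τ : ℝ => ∫ x in fundDomain A, h (x + τ • v)) = fun _ => ∫ x in fundDomain A, h x :=
    funext fun τ => hper.setIntegral_add_right hA _
  have h3 := key.2
  rw [h2] at h3
  simpa using h3.unique (hasDerivAt_const _ _)

lemma LatticePeriodic.setIntegral_pos (hA : IsUnit A.det) {h : E n → ℝ}
    (hper : LatticePeriodic A h) (hc : Continuous h) (h0 : ∀ x, 0 ≤ h x) {x : E n} (hx : h x ≠ 0) :
    0 < ∫ x in fundDomain A, h x := by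
  rw [hper.setIntegral_fundDomain hA]
  refine mul_pos (abs_pos.2 hA.ne_zero) ?_
  refine (hper.continuous_torusLift hc).integral_pos_of_hasCompactSupport_nonneg_nonzero
    (HasCompactSupport.of_compactSpace _) (fun t => h0 _)
    (x := fun i => ((A⁻¹.mulVec x.ofLp i : ℝ) : UnitAddCircle)) ?_
  rw [hper.torusLift_apply, matVec_inv hA]
  exact hx

end Torus

section Fourier

variable {n : ℕ} {A : Matrix (Fin n) (Fin n) ℝ}

/-- The vector of the dual lattice with integer coordinates `m` in the dual basis. -/
def dualVec (A : Matrix (Fin n) (Fin n) ℝ) (m : Fin n → ℤ) : E n :=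
  matVec A⁻¹.transpose fun i => (m i : ℝ)

/-- The character `x ↦ e^{-2πi⟨v,x⟩}`. -/
def latticeChar (v x : E n) : ℂ := Complex.exp (((-(2 * π * ⟪v, x⟫_ℝ) : ℝ) : ℂ) * Complex.I)

lemma inner_matVec (v : E n) (y : Fin n → ℝ) :
    ⟪v, matVec A y⟫_ℝ = (A.transpose.mulVec v.ofLp) ⬝ᵥ y := by
  rw [Matrix.mulVec_transpose, ← Matrix.dotProduct_mulVec, matVec]
  simp [PiLp.inner_apply, dotProduct, mul_comm]

lemma inner_dualVec (hA : IsUnit A.det) (m : Fin n → ℤ) (y : Fin n → ℝ) :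
    ⟪dualVec A m, matVec A y⟫_ℝ = ∑ i, (m i : ℝ) * y i := by
  rw [inner_matVec]
  have : A.transpose.mulVec (dualVec A m).ofLp = fun i => (m i : ℝ) := by
    simp [dualVec, matVec, Matrix.mulVec_mulVec, ← Matrix.transpose_mul,
      Matrix.nonsing_inv_mul _ hA]
  rw [this]
  rfl

lemma dualVec_mem (hA : IsUnit A.det) (m : Fin n → ℤ) : dualVec A m ∈ dualLattice (lattice A) := by
  rintro _ ⟨k, rfl⟩
  refine ⟨∑ i, m i * k i, ?_⟩
  rw [inner_dualVec hA]
  push_cast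
  rfl

lemma exists_dualVec_eq (hA : IsUnit A.det) {v : E n} (hv : v ∈ dualLattice (lattice A)) :
    ∃ m, v = dualVec A m ∧ ∀ i, (m i : ℝ) = ⟪v, matVec A (Pi.single i 1)⟫_ℝ := by
  have h : ∀ i, ∃ k : ℤ, ⟪v, matVec A (Pi.single i 1)⟫_ℝ = k := by
    intro i
    refine hv _ ⟨Pi.single i 1, ?_⟩
    congr 1
    ext j
    by_cases hj : j = i
    · subst hj; simp
    · simp [hj]
  choose m hm using h
  refine ⟨m, ?_, fun i => (hm i).symm⟩
  have h2 : A.transpose.mulVec v.ofLp = fun i => (m i : ℝ) := by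
    ext i
    rw [← hm i, inner_matVec]
    simp
  rw [dualVec, ← h2, matVec, Matrix.mulVec_mulVec, ← Matrix.transpose_mul,
    Matrix.mul_nonsing_inv _ hA]
  simp

lemma latticePeriodic_inner_comp {X : Type*} {v : E n} (hv : v ∈ dualLattice (lattice A))
    {G : ℝ → X} (hG : ∀ (x : ℝ) (k : ℤ), G (x + 2 * π * k) = G x) :
    LatticePeriodic A fun x => G (2 * π * ⟪v, x⟫_ℝ) := by
  intro x γ hγ
  obtain ⟨k, hk⟩ := hv γ hγ
  simp only [inner_add_right, hk, mul_add, hG]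

lemma latticePeriodic_latticeChar {v : E n} (hv : v ∈ dualLattice (lattice A)) :
    LatticePeriodic A (latticeChar v) := by
  refine latticePeriodic_inner_comp hv (G := fun s => Complex.exp (((-s : ℝ) : ℂ) * Complex.I)) ?_
  intro x k
  rw [Complex.exp_eq_exp_iff_exists_int]
  refine ⟨-k, ?_⟩
  push_cast
  ring

lemma contDiff_latticeChar (v : E n) : ContDiff ℝ 1 (latticeChar v) := by
  unfold latticeChar
  have h1 : ContDiff ℝ 1 fun x : E n => -(2 * π * ⟪v, x⟫_ℝ) :=
    (contDiff_const.mul (contDiff_const.inner ℝ contDiff_id)).neg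
  exact ((Complex.ofRealCLM.contDiff.comp h1).mul contDiff_const).cexp

lemma hasFDerivAt_latticeChar (v x u : E n) :
    fderiv ℝ (latticeChar v) x u = -(2 * π * ⟪v, u⟫_ℝ * Complex.I) * latticeChar v x := by
  have h0 : HasDerivAt (fun τ : ℝ => x + τ • u) u 0 := by
    simpa using ((hasDerivAt_id (0:ℝ)).smul_const u).const_add x
  have h1 : HasDerivAt (fun τ : ℝ => latticeChar v (x + τ • u))
      (fderiv ℝ (latticeChar v) x u) 0 := by
    have := ((contDiff_latticeChar v).differentiable one_ne_zero).differentiableAt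
      (x := x + (0:ℝ) • u)
    have h5 := this.hasFDerivAt.comp_hasDerivAt (0:ℝ) h0
    rw [zero_smul, add_zero] at h5
    exact h5
  have h2 : HasDerivAt (fun τ : ℝ => -(2 * π * (⟪v, x⟫_ℝ + τ * ⟪v, u⟫_ℝ)))
      (-(2 * π * ⟪v, u⟫_ℝ)) 0 := by
    simpa using! ((((hasDerivAt_id (0:ℝ)).mul_const ⟪v, u⟫_ℝ).const_add ⟪v, x⟫_ℝ).const_mul
      (2 * π)).neg
  have h3 := ((h2.ofReal_comp).mul_const Complex.I).cexp
  have h4 : (fun τ : ℝ => latticeChar v (x + τ • u)) = fun τ : ℝ =>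
      Complex.exp (((-(2 * π * (⟪v, x⟫_ℝ + τ * ⟪v, u⟫_ℝ)) : ℝ) : ℂ) * Complex.I) := by
    ext τ
    simp only [latticeChar, inner_add_right, inner_smul_right]
  rw [h4] at h1
  rw [h1.unique h3]
  simp only [latticeChar, zero_mul, add_zero]
  push_cast
  ring

lemma mFourier_neg_eq_latticeChar (hA : IsUnit A.det) (m : Fin n → ℤ) (y : Fin n → ℝ) :
    UnitAddTorus.mFourier (-m) (fun i => (y i : UnitAddCircle)) =
      latticeChar (dualVec A m) (matVec A y) := by
  rw [latticeChar, inner_dualVec hA]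
  simp only [UnitAddTorus.mFourier, ContinuousMap.coe_mk, fourier_coe_apply]
  rw [← Complex.exp_sum]
  congr 1
  push_cast
  rw [Finset.mul_sum, ← Finset.sum_neg_distrib, Finset.sum_mul]
  refine Finset.sum_congr rfl fun i _ => ?_
  simp
  ring

/-- **Parseval's identity** for periodic functions with respect to a general lattice. -/
lemma LatticePeriodic.hasSum_sq_coeff (hA : IsUnit A.det) {h : E n → ℂ}
    (hper : LatticePeriodic A h) (hc : Continuous h) :
    HasSum (fun m => ‖∫ x in fundDomain A, latticeChar (dualVec A m) x * h x‖ ^ 2)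
      (|A.det| * ∫ x in fundDomain A, ‖h x‖ ^ 2) := by
  have hD : 0 < |A.det| := abs_pos.2 hA.ne_zero
  let H : C(UnitAddTorus (Fin n), ℂ) := ⟨torusLift A h, hper.continuous_torusLift hc⟩
  have h1 := (UnitAddTorus.hasSum_sq_mFourierCoeff (H.toLp 2 volume ℂ)).mul_left (|A.det| ^ 2)
  have h2 : ∫ t, ‖(H.toLp 2 volume ℂ) t‖ ^ 2 = ∫ t, torusLift A (fun x => ‖h x‖ ^ 2) t := by
    refine integral_congr_ae ?_
    filter_upwards [ContinuousMap.coeFn_toLp (p := 2) (𝕜 := ℂ) volume H] with t ht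
    rw [ht]
    rfl
  have hper2 : LatticePeriodic A fun x => ‖h x‖ ^ 2 := fun x γ hγ => by simp only [hper x γ hγ]
  rw [h2] at h1
  rw [hper2.setIntegral_fundDomain hA, smul_eq_mul, ← mul_assoc, ← sq]
  refine h1.congr_fun fun m => ?_
  have hper3 : LatticePeriodic A fun x => latticeChar (dualVec A m) x * h x := fun x γ hγ => by
    simp only [hper x γ hγ, latticePeriodic_latticeChar (dualVec_mem hA m) x γ hγ]
  rw [UnitAddTorus.mFourierCoeff_toLp, hper3.setIntegral_fundDomain hA, norm_smul, mul_pow,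
    Real.norm_eq_abs, abs_abs, UnitAddTorus.mFourierCoeff]
  congr 4
  ext t
  obtain ⟨y, rfl⟩ := isOpenQuotientMap_torusMk.surjective t
  rw [hper3.torusLift_apply, mFourier_neg_eq_latticeChar hA, smul_eq_mul]
  congr 1
  exact (hper.torusLift_apply y).symm

lemma LatticePeriodic.coeff_fderiv (hA : IsUnit A.det) {h : E n → ℝ}
    (hper : LatticePeriodic A h) (hc : ContDiff ℝ 1 h) {v : E n}
    (hv : v ∈ dualLattice (lattice A)) (u : E n) :
    ∫ x in fundDomain A, latticeChar v x * (fderiv ℝ h x u : ℂ) =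
      (2 * π * ⟪v, u⟫_ℝ * Complex.I) * ∫ x in fundDomain A, latticeChar v x * (h x : ℂ) := by
  have hcC : ContDiff ℝ 1 fun x => (h x : ℂ) := Complex.ofRealCLM.contDiff.comp hc
  have hper' : LatticePeriodic A fun x => latticeChar v x * (h x : ℂ) := fun x γ hγ => by
    simp only [hper x γ hγ, latticePeriodic_latticeChar hv x γ hγ]
  have h1 := hper'.setIntegral_fderiv hA ((contDiff_latticeChar v).mul hcC) u
  have h2 : ∀ x, fderiv ℝ (fun x => latticeChar v x * (h x : ℂ)) x u =
      latticeChar v x * (fderiv ℝ h x u : ℂ) -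
        (2 * π * ⟪v, u⟫_ℝ * Complex.I) * (latticeChar v x * (h x : ℂ)) := by
    intro x
    have hd : HasFDerivAt (fun x => (h x : ℂ)) (Complex.ofRealCLM.comp (fderiv ℝ h x)) x :=
      Complex.ofRealCLM.hasFDerivAt.comp x
        ((hc.differentiable one_ne_zero).differentiableAt.hasFDerivAt)
    have hd2 := (((contDiff_latticeChar v).differentiable
      one_ne_zero).differentiableAt (x := x)).hasFDerivAt.mul hd
    have h3 : fderiv ℝ (fun x => latticeChar v x * (h x : ℂ)) x = _ := hd2.fderiv
    rw [h3]
    simp only [add_apply, smul_apply, smul_eq_mul,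
      ContinuousLinearMap.comp_apply, Complex.ofRealCLM_apply, hasFDerivAt_latticeChar]
    ring
  simp_rw [h2] at h1
  have hcd : Continuous fun x => fderiv ℝ h x u :=
    (hc.continuous_fderiv one_ne_zero).clm_apply continuous_const
  rw [integral_sub, integral_const_mul, sub_eq_zero] at h1
  · exact h1
  · exact integrableOn_fundDomain ((contDiff_latticeChar v).continuous.mul
      (Complex.continuous_ofReal.comp hcd))
  · exact integrableOn_fundDomain (continuous_const.mul
      ((contDiff_latticeChar v).continuous.mul hcC.continuous))

lemma norm_gradient_sq (h : E n → ℝ) (x : E n) :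
    ‖gradient h x‖ ^ 2 = ∑ i, (fderiv ℝ h x (EuclideanSpace.single i 1)) ^ 2 := by
  rw [EuclideanSpace.norm_sq_eq]
  refine Finset.sum_congr rfl fun i _ => ?_
  have : fderiv ℝ h x (EuclideanSpace.single i 1) =
      ⟪gradient h x, EuclideanSpace.single i 1⟫_ℝ := by
    simp [gradient]
  rw [this, EuclideanSpace.inner_single_right]
  simp

lemma norm_sq_eq_sum_inner (v : E n) : ‖v‖ ^ 2 = ∑ i, ⟪v, EuclideanSpace.single i (1:ℝ)⟫_ℝ ^ 2 := by
  rw [EuclideanSpace.norm_sq_eq]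
  refine Finset.sum_congr rfl fun i _ => ?_
  rw [EuclideanSpace.inner_single_right]
  simp

/-- Parseval's identity for the gradient. -/
lemma LatticePeriodic.hasSum_sq_coeff_gradient (hA : IsUnit A.det) {h : E n → ℝ}
    (hper : LatticePeriodic A h) (hc : ContDiff ℝ 1 h) :
    HasSum (fun m => 4 * π ^ 2 * ‖dualVec A m‖ ^ 2 *
        ‖∫ x in fundDomain A, latticeChar (dualVec A m) x * (h x : ℂ)‖ ^ 2)
      (|A.det| * ∫ x in fundDomain A, ‖gradient h x‖ ^ 2) := by
  have hcd : ∀ u, Continuous fun x => fderiv ℝ h x u := fun u =>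
    (hc.continuous_fderiv one_ne_zero).clm_apply continuous_const
  have hperd : ∀ u, LatticePeriodic A fun x => (fderiv ℝ h x u : ℂ) := fun u x γ hγ => by
    simp only [latticePeriodic_fderiv hper x γ hγ]
  have h1 := hasSum_sum (s := Finset.univ) fun (i : Fin n) _ =>
    (hperd (EuclideanSpace.single i 1)).hasSum_sq_coeff hA
      (Complex.continuous_ofReal.comp (hcd _))
  convert h1 using 1
  · ext m
    simp_rw [hper.coeff_fderiv hA hc (dualVec_mem hA m), norm_mul, mul_pow]
    rw [← Finset.sum_mul, norm_sq_eq_sum_inner, Finset.mul_sum]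
    congr 1
    refine Finset.sum_congr rfl fun i _ => ?_
    simp only [Complex.norm_I, Complex.norm_real, Real.norm_eq_abs, sq_abs, Complex.norm_ofNat]
    ring
  · rw [← Finset.mul_sum, ← integral_finsetSum]
    · simp_rw [norm_gradient_sq]
      simp
    · intro i _
      refine integrableOn_fundDomain ?_
      have := hcd (EuclideanSpace.single i 1)
      fun_prop

/-- The dual lattice has a spectral gap above the shortest vectors `±w`. -/
lemma exists_gap (hA : IsUnit A.det) {w : E n} (hgap : GapCondition (lattice A) w) :
    ∃ κ > ‖w‖ ^ 2, ∀ v ∈ dualLattice (lattice A), v ≠ 0 → v ≠ w → v ≠ -w → κ ≤ ‖v‖ ^ 2 := by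
  obtain ⟨hw, hw0, hlt⟩ := hgap
  let S : Set (E n) := {v | v ∈ dualLattice (lattice A) ∧ v ≠ 0 ∧ v ≠ w ∧ v ≠ -w ∧ ‖v‖ ≤ ‖w‖ + 1}
  have hS : S.Finite := by
    have hb : ∀ i : Fin n, ∃ K : ℤ, (‖w‖ + 1) * ‖matVec A (Pi.single i 1)‖ ≤ K := fun i =>
      ⟨_, Int.le_ceil _⟩
    choose K hK using hb
    refine ((Set.finite_Icc (-K) K).image (dualVec A)).subset ?_
    rintro v ⟨hv, -, -, -, hvn⟩
    obtain ⟨m, rfl, hm⟩ := exists_dualVec_eq hA hv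
    have hmK : ∀ i, |(m i : ℝ)| ≤ K i := fun i => by
      rw [hm i]
      exact (abs_real_inner_le_norm _ _).trans
        ((mul_le_mul_of_nonneg_right hvn (norm_nonneg _)).trans (hK i))
    refine ⟨m, ⟨fun i => ?_, fun i => ?_⟩, rfl⟩
    · have := (abs_le.1 (hmK i)).1
      simp only [Pi.neg_apply]
      exact_mod_cast this
    · exact_mod_cast (abs_le.1 (hmK i)).2
  have hw1 : ‖w‖ ^ 2 < (‖w‖ + 1) ^ 2 := by nlinarith [norm_nonneg w]
  rcases S.eq_empty_or_nonempty with hemp | hne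
  · refine ⟨(‖w‖ + 1) ^ 2, hw1, fun v hv h0 h1 h2 => ?_⟩
    by_contra hcon
    have : v ∈ S := ⟨hv, h0, h1, h2, (lt_of_pow_lt_pow_left₀ 2 (by positivity) (not_le.1 hcon)).le⟩
    rw [hemp] at this
    exact this
  · obtain ⟨v₀, ⟨hv, h0, h1, h2, -⟩, hmin⟩ := Set.exists_min_image S norm hS hne
    refine ⟨min ((‖w‖ + 1) ^ 2) (‖v₀‖ ^ 2), lt_min hw1
      (pow_lt_pow_left₀ (hlt v₀ hv h0 h1 h2) (norm_nonneg _) two_ne_zero), ?_⟩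
    intro v hv h0 h1 h2
    by_cases hvn : ‖v‖ ≤ ‖w‖ + 1
    · exact (min_le_right _ _).trans
        (pow_le_pow_left₀ (norm_nonneg _) (hmin v ⟨hv, h0, h1, h2, hvn⟩) 2)
    · exact (min_le_left _ _).trans (pow_le_pow_left₀ (by positivity) (not_le.1 hvn).le 2)

/-- **Poincaré inequality** on the complement of the constants and the first eigenspace. -/
lemma exists_poincare (hA : IsUnit A.det) {w : E n} (hgap : GapCondition (lattice A) w) :
    ∃ κ > 4 * π ^ 2 * ‖w‖ ^ 2, ∀ g : E n → ℝ, ContDiff ℝ 1 g → LatticePeriodic A g →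
      ∫ x in fundDomain A, g x = 0 →
      ∫ x in fundDomain A, g x * sin (2 * π * ⟪w, x⟫_ℝ) = 0 →
      ∫ x in fundDomain A, g x * cos (2 * π * ⟪w, x⟫_ℝ) = 0 →
      κ * ∫ x in fundDomain A, g x ^ 2 ≤ ∫ x in fundDomain A, ‖gradient g x‖ ^ 2 := by
  obtain ⟨κ, hκ, hmin⟩ := exists_gap hA hgap
  refine ⟨4 * π ^ 2 * κ, by have := pi_pos; gcongr, fun g hg hper h0 hs hc => ?_⟩
  have hD : 0 < |A.det| := abs_pos.2 hA.ne_zero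
  have hgC : Continuous fun x => (g x : ℂ) := Complex.continuous_ofReal.comp hg.continuous
  have hperC : LatticePeriodic A fun x => (g x : ℂ) := fun x γ hγ => by simp only [hper x γ hγ]
  have h1 := (hperC.hasSum_sq_coeff hA hgC).mul_left (4 * π ^ 2 * κ)
  have h2 := hper.hasSum_sq_coeff_gradient hA hg
  have hzero : ∀ σ : ℝ, ∫ x in fundDomain A, latticeChar (σ • w) x * (g x : ℂ) =
      ((∫ x in fundDomain A, g x * cos (σ * (2 * π * ⟪w, x⟫_ℝ)) : ℝ) : ℂ) -
      ((∫ x in fundDomain A, g x * sin (σ * (2 * π * ⟪w, x⟫_ℝ)) : ℝ) : ℂ) * Complex.I := by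
    intro σ
    rw [← integral_complex_ofReal, ← integral_complex_ofReal, ← integral_mul_const, ← integral_sub]
    · refine integral_congr_ae (Eventually.of_forall fun x => ?_)
      simp only [latticeChar]
      rw [Complex.exp_mul_I, ← Complex.ofReal_cos, ← Complex.ofReal_sin, inner_smul_left]
      simp only [conj_trivial, Real.cos_neg, Real.sin_neg, mul_left_comm σ]
      push_cast
      ring
    · refine integrableOn_fundDomain (Complex.continuous_ofReal.comp ?_)
      have := hg.continuous
      fun_prop
    · refine integrableOn_fundDomain ((Complex.continuous_ofReal.comp ?_).mul continuous_const)
      have := hg.continuous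
      fun_prop
  have hle : (4 * π ^ 2 * κ) * (|A.det| * ∫ x in fundDomain A, ‖(g x : ℂ)‖ ^ 2) ≤
      |A.det| * ∫ x in fundDomain A, ‖gradient g x‖ ^ 2 := by
    refine hasSum_le (fun m => ?_) h1 h2
    have hz : ∀ σ : ℝ, dualVec A m = σ • w →
        ∫ x in fundDomain A, g x * cos (σ * (2 * π * ⟪w, x⟫_ℝ)) = 0 →
        ∫ x in fundDomain A, g x * sin (σ * (2 * π * ⟪w, x⟫_ℝ)) = 0 →
        4 * π ^ 2 * κ * ‖∫ x in fundDomain A, latticeChar (dualVec A m) x * (g x : ℂ)‖ ^ 2 ≤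
        4 * π ^ 2 * ‖dualVec A m‖ ^ 2 *
          ‖∫ x in fundDomain A, latticeChar (dualVec A m) x * (g x : ℂ)‖ ^ 2 := by
      intro σ hσ hc hs
      rw [hσ, hzero, hc, hs]
      simp
    by_cases e0 : dualVec A m = 0
    · exact hz 0 (by simp [e0]) (by simpa using h0) (by simp)
    by_cases e1 : dualVec A m = w
    · exact hz 1 (by simp [e1]) (by simpa using hc) (by simpa using hs)
    by_cases e2 : dualVec A m = -w
    · exact hz (-1) (by simp [e2]) (by simpa using hc) (by simpa [integral_neg] using hs)
    have := hmin _ (dualVec_mem hA m) e0 e1 e2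
    gcongr
  have h3 : ∀ x, ‖(g x : ℂ)‖ ^ 2 = g x ^ 2 := fun x => by simp
  simp_rw [h3] at hle
  rw [mul_left_comm] at hle
  exact le_of_mul_le_mul_left hle hD

end Fourier

section PlaneWave

variable {n : ℕ} {A : Matrix (Fin n) (Fin n) ℝ}

lemma hasFDerivAt_comp_phase {G : ℝ → ℝ} {G' : ℝ} (w x : E n)
    (hG : HasDerivAt G G' (2 * π * ⟪w, x⟫_ℝ)) :
    HasFDerivAt (fun x : E n => G (2 * π * ⟪w, x⟫_ℝ)) (G' • (2 * π) • innerSL ℝ w) x := by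
  have h : HasFDerivAt (fun x : E n => 2 * π * ⟪w, x⟫_ℝ) ((2 * π) • innerSL ℝ w) x :=
    (innerSL ℝ w).hasFDerivAt.const_mul (2 * π)
  exact hG.comp_hasFDerivAt x h

lemma contDiff_phase (w : E n) : ContDiff ℝ 1 fun x : E n => 2 * π * ⟪w, x⟫_ℝ :=
  contDiff_const.mul (contDiff_const.inner ℝ contDiff_id)

lemma sin_add_two_pi_int (x : ℝ) (k : ℤ) : sin (x + 2 * π * k) = sin x := by
  rw [mul_comm]; exact sin_add_int_mul_two_pi x k

lemma cos_add_two_pi_int (x : ℝ) (k : ℤ) : cos (x + 2 * π * k) = cos x := by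
  rw [mul_comm]; exact cos_add_int_mul_two_pi x k

/-- The integral of the derivative of a plane wave profile vanishes. -/
lemma setIntegral_deriv_phase (hA : IsUnit A.det) {w : E n} (hw : w ∈ dualLattice (lattice A))
    (hw0 : w ≠ 0) {G G' : ℝ → ℝ} (hG : ∀ s, HasDerivAt G (G' s) s) (hc : ContDiff ℝ 1 G)
    (hp : ∀ (s : ℝ) (k : ℤ), G (s + 2 * π * k) = G s) :
    ∫ x in fundDomain A, G' (2 * π * ⟪w, x⟫_ℝ) = 0 := by
  have h := (latticePeriodic_inner_comp hw hp).setIntegral_fderiv hA (hc.comp (contDiff_phase w)) w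
  simp_rw [fun x => (hasFDerivAt_comp_phase w x (hG _)).fderiv] at h
  simp only [smul_apply, innerSL_apply_apply, smul_eq_mul] at h
  rw [integral_mul_const] at h
  refine (mul_eq_zero.1 h).resolve_right ?_
  simp [pi_ne_zero, hw0]

lemma setIntegral_cos_mul_comp_sin (hA : IsUnit A.det) {w : E n}
    (hw : w ∈ dualLattice (lattice A)) (hw0 : w ≠ 0) {ψ : ℝ → ℝ} (hψ : Continuous ψ) :
    ∫ x in fundDomain A, cos (2 * π * ⟪w, x⟫_ℝ) * ψ (sin (2 * π * ⟪w, x⟫_ℝ)) = 0 := by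
  have hΨ : ∀ u, HasDerivAt (fun u => ∫ v in (0:ℝ)..u, ψ v) (ψ u) u := fun u =>
    (hψ.integral_hasStrictDerivAt 0 u).hasDerivAt
  have hΨc : ContDiff ℝ 1 fun u => ∫ v in (0:ℝ)..u, ψ v := by
    rw [contDiff_one_iff_deriv]
    refine ⟨fun u => (hΨ u).differentiableAt, ?_⟩
    rw [funext fun u => (hΨ u).deriv]
    exact hψ
  refine setIntegral_deriv_phase hA hw hw0 (G := fun s => ∫ v in (0:ℝ)..(sin s), ψ v)
    (G' := fun s => cos s * ψ (sin s)) (fun s => ?_) (hΨc.comp contDiff_sin) (fun s k => ?_)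
  · rw [mul_comm]
    exact (hΨ (sin s)).comp s (hasDerivAt_sin s)
  · simp only [sin_add_two_pi_int]

lemma setIntegral_one (hA : IsUnit A.det) : ∫ _ in fundDomain A, (1:ℝ) = |A.det| := by
  have h : LatticePeriodic A fun _ => (1:ℝ) := fun _ _ _ => rfl
  rw [h.setIntegral_fundDomain hA]
  simp [torusLift]

lemma setIntegral_sin_sq (hA : IsUnit A.det) {w : E n}
    (hw : w ∈ dualLattice (lattice A)) (hw0 : w ≠ 0) :
    ∫ x in fundDomain A, sin (2 * π * ⟪w, x⟫_ℝ) ^ 2 = |A.det| / 2 := by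
  have h := setIntegral_deriv_phase hA hw hw0 (G := fun s => sin s * cos s)
    (G' := fun s => 1 - 2 * sin s ^ 2) (fun s => by
      convert! (hasDerivAt_sin s).mul (hasDerivAt_cos s) using 1
      linear_combination -(sin_sq_add_cos_sq s)) (contDiff_sin.mul contDiff_cos)
    (fun s k => by simp only [sin_add_two_pi_int, cos_add_two_pi_int])
  rw [integral_sub (integrableOn_fundDomain (by fun_prop)) (integrableOn_fundDomain (by fun_prop)),
    integral_const_mul, setIntegral_one hA] at h
  linarith

lemma setIntegral_sin_pow_four (hA : IsUnit A.det) {w : E n}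
    (hw : w ∈ dualLattice (lattice A)) (hw0 : w ≠ 0) :
    ∫ x in fundDomain A, sin (2 * π * ⟪w, x⟫_ℝ) ^ 4 = 3 * |A.det| / 8 := by
  have h := setIntegral_deriv_phase hA hw hw0 (G := fun s => sin s ^ 3 * cos s)
    (G' := fun s => 3 * sin s ^ 2 - 4 * sin s ^ 4) (fun s => by
      convert! ((hasDerivAt_sin s).pow 3).mul (hasDerivAt_cos s) using 1
      simp only [Nat.cast_ofNat, Nat.add_one_sub_one, Pi.pow_apply]
      linear_combination -3 * sin s ^ 2 * (sin_sq_add_cos_sq s))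
    ((contDiff_sin.pow 3).mul contDiff_cos)
    (fun s k => by simp only [sin_add_two_pi_int, cos_add_two_pi_int])
  rw [integral_sub (integrableOn_fundDomain (by fun_prop)) (integrableOn_fundDomain (by fun_prop)),
    integral_const_mul, integral_const_mul, setIntegral_sin_sq hA hw hw0] at h
  linarith

lemma setIntegral_sin (hA : IsUnit A.det) {w : E n}
    (hw : w ∈ dualLattice (lattice A)) (hw0 : w ≠ 0) :
    ∫ x in fundDomain A, sin (2 * π * ⟪w, x⟫_ℝ) = 0 :=
  setIntegral_deriv_phase hA hw hw0 (G := fun s => -cos s) (G' := sin)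
    (fun s => by simpa using! (hasDerivAt_cos s).neg) contDiff_cos.neg
    (fun s k => by simp only [cos_add_two_pi_int])

lemma setIntegral_sin_pow_three (hA : IsUnit A.det) {w : E n}
    (hw : w ∈ dualLattice (lattice A)) (hw0 : w ≠ 0) :
    ∫ x in fundDomain A, sin (2 * π * ⟪w, x⟫_ℝ) ^ 3 = 0 := by
  have h := setIntegral_deriv_phase hA hw hw0 (G := fun s => sin s ^ 2 * cos s)
    (G' := fun s => 2 * sin s - 3 * sin s ^ 3) (fun s => by
      convert! ((hasDerivAt_sin s).pow 2).mul (hasDerivAt_cos s) using 1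
      simp only [Nat.cast_ofNat, Nat.add_one_sub_one, Pi.pow_apply]
      linear_combination -2 * sin s * (sin_sq_add_cos_sq s))
    ((contDiff_sin.pow 2).mul contDiff_cos)
    (fun s k => by simp only [sin_add_two_pi_int, cos_add_two_pi_int])
  rw [integral_sub (integrableOn_fundDomain (by fun_prop)) (integrableOn_fundDomain (by fun_prop)),
    integral_const_mul, integral_const_mul, setIntegral_sin hA hw hw0] at h
  linarith

/-- The weighted energy form `∫ |∇h|² e^{a sin θ} - Λ ∫ h² e^{b sin θ}`, `θ = 2π⟨w,x⟩`. -/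
def energyForm (A : Matrix (Fin n) (Fin n) ℝ) (w : E n) (a b Λ : ℝ) (h : E n → ℝ) : ℝ :=
  (∫ x in fundDomain A, ‖gradient h x‖ ^ 2 * exp (a * sin (2 * π * ⟪w, x⟫_ℝ))) -
    Λ * ∫ x in fundDomain A, h x ^ 2 * exp (b * sin (2 * π * ⟪w, x⟫_ℝ))

lemma gradient_add_phase {w : E n} {g : E n → ℝ} (hg : ContDiff ℝ 1 g) {F F' : ℝ → ℝ}
    (hF : ∀ s, HasDerivAt F (F' s) s) (x : E n) :
    gradient (fun x => g x + F (2 * π * ⟪w, x⟫_ℝ)) x =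
      gradient g x + (F' (2 * π * ⟪w, x⟫_ℝ) * (2 * π)) • w := by
  have h1 := ((hg.differentiable one_ne_zero).differentiableAt (x := x)).hasFDerivAt.add
    (hasFDerivAt_comp_phase w x (hF _))
  have h2 : fderiv ℝ (fun x => g x + F (2 * π * ⟪w, x⟫_ℝ)) x = _ := h1.fderiv
  rw [gradient, h2, map_add, gradient, smul_smul, map_smul]
  congr 2
  exact (InnerProductSpace.toDual ℝ (E n)).symm_apply_apply w

lemma continuous_gradient {g : E n → ℝ} (hg : ContDiff ℝ 1 g) : Continuous (gradient g) :=
  (InnerProductSpace.toDual ℝ (E n)).symm.continuous.comp (hg.continuous_fderiv one_ne_zero)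

/-- Expansion of the energy form around a plane wave profile `F`. -/
lemma energyForm_add_phase (hA : IsUnit A.det) {w : E n} (hw : w ∈ dualLattice (lattice A))
    {g : E n → ℝ} (hg : ContDiff ℝ 1 g) (hper : LatticePeriodic A g) {F F' F'' r : ℝ → ℝ}
    (hF : ∀ s, HasDerivAt F (F' s) s) (hF' : ∀ s, HasDerivAt F' (F'' s) s)
    (hFc : ContDiff ℝ 1 F) (hFc' : ContDiff ℝ 1 F') (hF'' : Continuous F'')
    (hp : ∀ (s : ℝ) (k : ℤ), F (s + 2 * π * k) = F s)
    (hp' : ∀ (s : ℝ) (k : ℤ), F' (s + 2 * π * k) = F' s) (a b M : ℝ)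
    (hr : ∀ s, r s = -(F'' s + a * cos s * F' s) * exp (a * sin s) - M * F s * exp (b * sin s)) :
    energyForm A w a b (4 * π ^ 2 * ‖w‖ ^ 2 * M) (fun x => g x + F (2 * π * ⟪w, x⟫_ℝ)) =
      energyForm A w a b (4 * π ^ 2 * ‖w‖ ^ 2 * M) g +
      2 * (4 * π ^ 2 * ‖w‖ ^ 2) * (∫ x in fundDomain A, g x * r (2 * π * ⟪w, x⟫_ℝ)) +
      4 * π ^ 2 * ‖w‖ ^ 2 * ∫ x in fundDomain A, F (2 * π * ⟪w, x⟫_ℝ) * r (2 * π * ⟪w, x⟫_ℝ) := by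
  have hθ := contDiff_phase w
  have hFθ : ContDiff ℝ 1 fun x : E n => F (2 * π * ⟪w, x⟫_ℝ) := hFc.comp hθ
  have hθc : Continuous fun x : E n => 2 * π * ⟪w, x⟫_ℝ := hθ.continuous
  have hrc : Continuous r := by
    have h1 := hFc.continuous
    have h2 := hFc'.continuous
    rw [funext hr]
    fun_prop
  have hP : ∀ s, HasDerivAt (fun s => F' s * exp (a * sin s))
      (F'' s * exp (a * sin s) + F' s * (exp (a * sin s) * (a * cos s))) s := fun s =>
    (hF' s).mul ((hasDerivAt_sin s).const_mul a).exp
  have hPc : ContDiff ℝ 1 fun s => F' s * exp (a * sin s) :=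
    hFc'.mul (contDiff_const.mul contDiff_sin).exp
  let V : E n → ℝ := fun x => (2 * g x + F (2 * π * ⟪w, x⟫_ℝ)) *
    (F' (2 * π * ⟪w, x⟫_ℝ) * exp (a * sin (2 * π * ⟪w, x⟫_ℝ)))
  have hVc : ContDiff ℝ 1 V := ((contDiff_const.mul hg).add hFθ).mul (hPc.comp hθ)
  have hVp : LatticePeriodic A V := by
    intro x γ hγ
    obtain ⟨k, hk⟩ := hw γ hγ
    simp only [V, hper x γ hγ, inner_add_right, hk, mul_add, hp, hp', sin_add_two_pi_int]
  have hV := hVp.setIntegral_fderiv hA hVc ((2 * π) • w)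
  have hVd : ∀ x, fderiv ℝ V x ((2 * π) • w) =
      (2 * fderiv ℝ g x ((2 * π) • w) + 4 * π ^ 2 * ‖w‖ ^ 2 * F' (2 * π * ⟪w, x⟫_ℝ)) *
        (F' (2 * π * ⟪w, x⟫_ℝ) * exp (a * sin (2 * π * ⟪w, x⟫_ℝ))) +
      (2 * g x + F (2 * π * ⟪w, x⟫_ℝ)) * (4 * π ^ 2 * ‖w‖ ^ 2 *
        (F'' (2 * π * ⟪w, x⟫_ℝ) * exp (a * sin (2 * π * ⟪w, x⟫_ℝ)) + F' (2 * π * ⟪w, x⟫_ℝ) *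
          (exp (a * sin (2 * π * ⟪w, x⟫_ℝ)) * (a * cos (2 * π * ⟪w, x⟫_ℝ))))) := by
    intro x
    have h1 := ((((hg.differentiable one_ne_zero).differentiableAt (x := x)).hasFDerivAt.const_mul
      2).add (hasFDerivAt_comp_phase w x (hF _))).mul (hasFDerivAt_comp_phase w x (hP _))
    have h2 : fderiv ℝ V x = _ := h1.fderiv
    rw [h2]
    simp only [add_apply, smul_apply, innerSL_apply_apply, smul_eq_mul, inner_smul_right,
      real_inner_self_eq_norm_sq, Pi.add_apply]
    ring
  have hgrad : ∀ x, ‖gradient (fun x => g x + F (2 * π * ⟪w, x⟫_ℝ)) x‖ ^ 2 =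
      ‖gradient g x‖ ^ 2 + 2 * F' (2 * π * ⟪w, x⟫_ℝ) * fderiv ℝ g x ((2 * π) • w) +
        4 * π ^ 2 * ‖w‖ ^ 2 * F' (2 * π * ⟪w, x⟫_ℝ) ^ 2 := by
    intro x
    have h1 : fderiv ℝ g x ((2 * π) • w) = ⟪gradient g x, (2 * π) • w⟫_ℝ := by
      simp [gradient]
    rw [gradient_add_phase hg hF, norm_add_sq_real, h1, norm_smul, mul_pow, inner_smul_right,
      inner_smul_right, Real.norm_eq_abs, sq_abs]
    ring
  have hgc := hg.continuous
  have hggc := continuous_gradient hg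
  have hFcc := hFc.continuous
  have hFcc' := hFc'.continuous
  have hVdc : Continuous fun x => fderiv ℝ V x ((2 * π) • w) :=
    (hVc.continuous_fderiv one_ne_zero).clm_apply continuous_const
  have hggc' : Continuous (gradient fun x => g x + F (2 * π * ⟪w, x⟫_ℝ)) :=
    continuous_gradient (hg.add hFθ)
  rw [← add_zero (_ + 4 * π ^ 2 * ‖w‖ ^ 2 * ∫ x in fundDomain A, _), ← hV]
  unfold energyForm
  rw [← integral_const_mul, ← integral_const_mul, ← integral_const_mul, ← integral_const_mul,
    ← integral_sub, ← integral_sub, ← integral_add, ← integral_add, ← integral_add]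
  · refine integral_congr_ae (Eventually.of_forall fun x => ?_)
    simp only [hVd, hgrad, hr]
    ring
  all_goals
    refine integrableOn_fundDomain ?_
    fun_prop

/-- Adding a constant to a function of zero weighted mean decreases the energy form. -/
lemma energyForm_sub_const_le {w : E n} {a b Λ : ℝ} (hΛ : 0 ≤ Λ) {f : E n → ℝ}
    (hf : ContDiff ℝ 1 f)
    (hmean : ∫ x in fundDomain A, f x * exp (b * sin (2 * π * ⟪w, x⟫_ℝ)) = 0) (k : ℝ) :
    energyForm A w a b Λ (fun x => f x - k) ≤ energyForm A w a b Λ f := by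
  have hgrad : ∀ x, gradient (fun x => f x - k) x = gradient f x := fun x => by
    simp only [gradient, fderiv_sub_const]
  have hfc := hf.continuous
  unfold energyForm
  simp_rw [hgrad]
  have h1 : ∫ x in fundDomain A, (f x - k) ^ 2 * exp (b * sin (2 * π * ⟪w, x⟫_ℝ)) =
      (∫ x in fundDomain A, f x ^ 2 * exp (b * sin (2 * π * ⟪w, x⟫_ℝ))) -
      2 * k * (∫ x in fundDomain A, f x * exp (b * sin (2 * π * ⟪w, x⟫_ℝ))) +
      k ^ 2 * ∫ x in fundDomain A, exp (b * sin (2 * π * ⟪w, x⟫_ℝ)) := by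
    rw [← integral_const_mul, ← integral_const_mul, ← integral_sub, ← integral_add]
    · refine integral_congr_ae (Eventually.of_forall fun x => ?_)
      ring
    all_goals
      refine integrableOn_fundDomain ?_
      fun_prop
  have h2 : 0 ≤ ∫ x in fundDomain A, exp (b * sin (2 * π * ⟪w, x⟫_ℝ)) :=
    integral_nonneg fun x => (exp_pos _).le
  rw [h1, hmean]
  have := mul_nonneg hΛ (mul_nonneg (sq_nonneg k) h2)
  linarith

end PlaneWave

section Residual

lemma exists_exp_eq_taylor (c : ℝ) : ∃ K, ∀ s x : ℝ, |s| ≤ 1 → |x| ≤ 1 →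
    ∃ η, |η| ≤ K ∧ exp (c * s * x) = 1 + s * (c * x) + s ^ 2 * (c ^ 2 * x ^ 2 / 2) + s ^ 3 * η := by
  refine ⟨|c| ^ 3 * exp |c|, fun s x hs hx => ?_⟩
  rcases eq_or_ne s 0 with rfl | hs0
  · exact ⟨0, by rw [abs_zero]; positivity, by simp⟩
  refine ⟨(exp (c * s * x) - (1 + s * (c * x) + s ^ 2 * (c ^ 2 * x ^ 2 / 2))) / s ^ 3, ?_, ?_⟩
  · have h1 := Complex.norm_exp_sub_sum_le_norm_mul_exp ((c * s * x : ℝ) : ℂ) 3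
    have h2 : Complex.exp ((c * s * x : ℝ) : ℂ) -
        ∑ m ∈ Finset.range 3, ((c * s * x : ℝ) : ℂ) ^ m / (m.factorial : ℂ) =
        ((exp (c * s * x) - (1 + s * (c * x) + s ^ 2 * (c ^ 2 * x ^ 2 / 2)) : ℝ) : ℂ) := by
      simp only [Finset.sum_range_succ, Finset.sum_range_zero]
      push_cast
      simp
      ring
    rw [h2, Complex.norm_real, Complex.norm_real, Real.norm_eq_abs, Real.norm_eq_abs] at h1
    rw [abs_div, abs_pow, div_le_iff₀ (by positivity)]
    refine h1.trans ?_
    rw [abs_mul, abs_mul, mul_pow, mul_pow]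
    have h3 : |c| * |s| * |x| ≤ |c| := by
      calc |c| * |s| * |x| ≤ |c| * 1 * 1 := by gcongr
        _ = |c| := by ring
    calc |c| ^ 3 * |s| ^ 3 * |x| ^ 3 * exp (|c| * |s| * |x|)
        ≤ |c| ^ 3 * |s| ^ 3 * 1 ^ 3 * exp |c| := by gcongr
      _ = |c| ^ 3 * exp |c| * |s| ^ 3 := by ring
  · field_simp
    ring

/-- Second-order expansion of a residual whose terms of order zero and one cancel. -/
lemma exists_residual_bound {U₀ U₁ U₂ V₀ V₁ Φ₀ Φ₁ ρ : ℝ → ℝ} (hU₀ : Continuous U₀)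
    (hU₁ : Continuous U₁) (hU₂ : Continuous U₂) (hV₀ : Continuous V₀) (hV₁ : Continuous V₁)
    (hΦ₀ : Continuous Φ₀) (hΦ₁ : Continuous Φ₁) (a b m : ℝ)
    (h0 : ∀ x, U₀ x + V₀ x = 0)
    (h1 : ∀ x, U₀ x * (a * x) + U₁ x + V₀ x * (b * x) + V₁ x = 0)
    (hρ : ∀ x, ρ x = U₂ x + U₁ x * (a * x) + U₀ x * (a ^ 2 * x ^ 2 / 2) + m * V₀ x +
      V₁ x * (b * x) + V₀ x * (b ^ 2 * x ^ 2 / 2)) :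
    ∃ K, 0 ≤ K ∧ ∀ s x r : ℝ, |s| ≤ 1 → |x| ≤ 1 →
      r = (U₀ x + s * U₁ x + s ^ 2 * U₂ x) * exp (a * s * x) +
        (1 + m * s ^ 2) * (V₀ x + s * V₁ x) * exp (b * s * x) →
      |r| ≤ K * s ^ 2 ∧
      |(Φ₀ x + s * Φ₁ x) * r - s ^ 2 * (Φ₀ x * ρ x)| ≤ K * |s| ^ 3 := by
  obtain ⟨Ka, hKa⟩ := exists_exp_eq_taylor a
  obtain ⟨Kb, hKb⟩ := exists_exp_eq_taylor b
  let R : ℝ × ℝ × ℝ × ℝ → ℝ := fun p =>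
    U₁ p.2.1 * (a ^ 2 * p.2.1 ^ 2 / 2) + U₂ p.2.1 * (a * p.2.1) +
    p.1 * U₂ p.2.1 * (a ^ 2 * p.2.1 ^ 2 / 2) +
    (U₀ p.2.1 + p.1 * U₁ p.2.1 + p.1 ^ 2 * U₂ p.2.1) * p.2.2.1 +
    V₁ p.2.1 * (b ^ 2 * p.2.1 ^ 2 / 2) + m * (V₀ p.2.1 * (b * p.2.1) + V₁ p.2.1) +
    p.1 * m * (V₀ p.2.1 * (b ^ 2 * p.2.1 ^ 2 / 2) + V₁ p.2.1 * (b * p.2.1)) +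
    p.1 ^ 2 * m * V₁ p.2.1 * (b ^ 2 * p.2.1 ^ 2 / 2) +
    (1 + m * p.1 ^ 2) * (V₀ p.2.1 + p.1 * V₁ p.2.1) * p.2.2.2
  let S : Set (ℝ × ℝ × ℝ × ℝ) :=
    Set.Icc (-1) 1 ×ˢ Set.Icc (-1) 1 ×ˢ Set.Icc (-Ka) Ka ×ˢ Set.Icc (-Kb) Kb
  have hS : IsCompact S :=
    isCompact_Icc.prod (isCompact_Icc.prod (isCompact_Icc.prod isCompact_Icc))
  have hρc : Continuous ρ := by
    rw [funext hρ]
    fun_prop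
  have hR : Continuous R := by fun_prop
  have hR1 : Continuous fun p : ℝ × ℝ × ℝ × ℝ => ρ p.2.1 + p.1 * R p := by fun_prop
  have hR2 : Continuous fun p : ℝ × ℝ × ℝ × ℝ =>
    Φ₁ p.2.1 * (ρ p.2.1 + p.1 * R p) + Φ₀ p.2.1 * R p := by fun_prop
  obtain ⟨K₁, hK₁⟩ := hS.exists_bound_of_continuousOn hR1.continuousOn
  obtain ⟨K₂, hK₂⟩ := hS.exists_bound_of_continuousOn hR2.continuousOn
  refine ⟨max 0 (max K₁ K₂), le_max_left _ _, fun s x r hs hx hr => ?_⟩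
  obtain ⟨ηa, hηa, hea⟩ := hKa s x hs hx
  obtain ⟨ηb, hηb, heb⟩ := hKb s x hs hx
  have hmem : (s, x, ηa, ηb) ∈ S := ⟨abs_le.1 hs, abs_le.1 hx, abs_le.1 hηa, abs_le.1 hηb⟩
  have hr' : r = s ^ 2 * (ρ x + s * R (s, x, ηa, ηb)) := by
    rw [hr, hea, heb, hρ]
    simp only [R]
    linear_combination h0 x + s * h1 x
  have b1 := hK₁ _ hmem
  have b2 := hK₂ _ hmem
  simp only [Real.norm_eq_abs] at b1 b2
  constructor
  · rw [hr', abs_mul, abs_of_nonneg (sq_nonneg s), mul_comm]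
    exact mul_le_mul_of_nonneg_right (b1.trans ((le_max_left _ _).trans (le_max_right _ _)))
      (sq_nonneg s)
  · have : (Φ₀ x + s * Φ₁ x) * r - s ^ 2 * (Φ₀ x * ρ x) =
        (Φ₁ x * (ρ x + s * R (s, x, ηa, ηb)) + Φ₀ x * R (s, x, ηa, ηb)) * s ^ 3 := by
      rw [hr']; ring
    rw [this, abs_mul, abs_pow]
    exact mul_le_mul_of_nonneg_right (b2.trans ((le_max_right _ _).trans (le_max_right _ _)))
      (by positivity)

/-- First-order approximation of the eigenfunction branch starting at `sin`. -/
def sinProfile (q b s θ : ℝ) : ℝ := sin θ + s * (-(q * (1 - 2 * sin θ ^ 2)) - b / 2)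

/-- First-order approximation of the eigenfunction branch starting at `cos`. -/
def cosProfile (q s θ : ℝ) : ℝ := cos θ * (1 + s * (2 * q * sin θ))

/-- The residual of `sinProfile`, as a function of `x = sin θ`. -/
def sinResidual (a b q m s x : ℝ) : ℝ :=
  (x + s * (-(4 * q * (1 - 2 * x ^ 2) + a * (1 - x ^ 2))) +
    s ^ 2 * (-(4 * a * q * x * (1 - x ^ 2)))) * exp (a * s * x) +
  (1 + m * s ^ 2) * (-x + s * (q * (1 - 2 * x ^ 2) + b / 2)) * exp (b * s * x)

/-- The residual of `cosProfile`, divided by `cos θ`, as a function of `x = sin θ`. -/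
def cosResidual (a b q m s x : ℝ) : ℝ :=
  (1 + s * (8 * q * x + a * x) + s ^ 2 * (-(2 * a * q * (1 - 2 * x ^ 2)))) * exp (a * s * x) +
  (1 + m * s ^ 2) * (-1 + s * (-(2 * q * x))) * exp (b * s * x)

lemma continuous_sinResidual (a b q m s : ℝ) : Continuous (sinResidual a b q m s) := by
  unfold sinResidual
  fun_prop

lemma continuous_cosResidual (a b q m s : ℝ) : Continuous (cosResidual a b q m s) := by
  unfold cosResidual
  fun_prop

variable {n : ℕ} {A : Matrix (Fin n) (Fin n) ℝ}

lemma setIntegral_even_quartic (hA : IsUnit A.det) {w : E n}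
    (hw : w ∈ dualLattice (lattice A)) (hw0 : w ≠ 0) (c₀ c₂ c₄ : ℝ) :
    ∫ x in fundDomain A, (c₀ + c₂ * sin (2 * π * ⟪w, x⟫_ℝ) ^ 2 +
      c₄ * sin (2 * π * ⟪w, x⟫_ℝ) ^ 4) = |A.det| * (c₀ + c₂ / 2 + 3 * c₄ / 8) := by
  have h0 : ∫ x in fundDomain A, c₀ = c₀ * |A.det| := by
    rw [← setIntegral_one hA, ← integral_const_mul]
    simp
  rw [integral_add, integral_add, integral_const_mul, integral_const_mul,
    setIntegral_sin_sq hA hw hw0, setIntegral_sin_pow_four hA hw hw0, h0]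
  · ring
  all_goals
    refine integrableOn_fundDomain ?_
    fun_prop

lemma abs_setIntegral_sub_le {H G : E n → ℝ} (hA : IsUnit A.det) (hH : Continuous H)
    (hG : Continuous G) {C : ℝ} (h : ∀ x, |H x - G x| ≤ C) :
    |(∫ x in fundDomain A, H x) - ∫ x in fundDomain A, G x| ≤ C * |A.det| := by
  rw [← integral_sub (integrableOn_fundDomain hH) (integrableOn_fundDomain hG)]
  have h1 : ∫ x in fundDomain A, C = C * |A.det| := by
    rw [← setIntegral_one hA, ← integral_const_mul]
    simp
  rw [← h1, ← Real.norm_eq_abs]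
  exact norm_integral_le_of_norm_le (integrableOn_fundDomain continuous_const)
    (Eventually.of_forall h)

/-- The second-order coefficient of the `cos` branch. -/
def cosCoeff (a b : ℝ) : ℝ := a ^ 2 / 24 + a * b / 3 - 5 * b ^ 2 / 24

/-- The second-order coefficient of the `sin` branch. -/
def sinCoeff (a b : ℝ) : ℝ := b ^ 2 / 24 + a * b / 3 - 5 * a ^ 2 / 24

lemma exists_sin_bound (hA : IsUnit A.det) {w : E n} (hw : w ∈ dualLattice (lattice A))
    (hw0 : w ≠ 0) {a b q : ℝ} (hq : 3 * q = b / 2 - a) (m : ℝ) :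
    ∃ K, 0 ≤ K ∧ ∀ s, |s| ≤ 1 → (∀ θ, |sinResidual a b q m s (sin θ)| ≤ K * s ^ 2) ∧
      |(∫ x in fundDomain A, sinProfile q b s (2 * π * ⟪w, x⟫_ℝ) *
        sinResidual a b q m s (sin (2 * π * ⟪w, x⟫_ℝ))) -
        s ^ 2 * (|A.det| / 2 * (sinCoeff a b - m))| ≤ K * |s| ^ 3 * |A.det| := by
  obtain ⟨K, hK0, hK⟩ := exists_residual_bound (U₀ := fun x => x)
    (U₁ := fun x => -(4 * q * (1 - 2 * x ^ 2) + a * (1 - x ^ 2)))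
    (U₂ := fun x => -(4 * a * q * x * (1 - x ^ 2))) (V₀ := fun x => -x)
    (V₁ := fun x => q * (1 - 2 * x ^ 2) + b / 2) (Φ₀ := fun x => x)
    (Φ₁ := fun x => -(q * (1 - 2 * x ^ 2)) - b / 2)
    (by fun_prop) (by fun_prop) (by fun_prop) (by fun_prop) (by fun_prop) (by fun_prop)
    (by fun_prop) a b m (fun x => by ring)
    (fun x => by linear_combination -(1 - 2 * x ^ 2) * hq) (fun x => rfl)
  refine ⟨K, hK0, fun s hs => ⟨fun θ => (hK s (sin θ) _ hs (abs_sin_le_one θ) rfl).1, ?_⟩⟩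
  have h := abs_setIntegral_sub_le hA (C := K * |s| ^ 3)
    (H := fun x => sinProfile q b s (2 * π * ⟪w, x⟫_ℝ) *
      sinResidual a b q m s (sin (2 * π * ⟪w, x⟫_ℝ)))
    (G := fun x => s ^ 2 * (0 + (-(8 * a * q) - a ^ 2 - m + b * q + b ^ 2 / 2) *
        sin (2 * π * ⟪w, x⟫_ℝ) ^ 2 +
      (12 * a * q + 3 * a ^ 2 / 2 - 2 * b * q - b ^ 2 / 2) * sin (2 * π * ⟪w, x⟫_ℝ) ^ 4))
    (by
      have := continuous_sinResidual a b q m s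
      unfold sinProfile
      fun_prop)
    (by fun_prop) (fun x => by
      convert! (hK s (sin (2 * π * ⟪w, x⟫_ℝ)) _ hs (abs_sin_le_one _) rfl).2 using 2
      rw [sinProfile, sinResidual]
      ring)
  rw [integral_const_mul, setIntegral_even_quartic hA hw hw0] at h
  convert! h using 3
  have : q = (b / 2 - a) / 3 := by linarith
  rw [sinCoeff, this]
  ring

lemma exists_cos_bound (hA : IsUnit A.det) {w : E n} (hw : w ∈ dualLattice (lattice A))
    (hw0 : w ≠ 0) {a b q : ℝ} (hq : 3 * q = b / 2 - a) (m : ℝ) :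
    ∃ K, 0 ≤ K ∧ ∀ s, |s| ≤ 1 → (∀ θ, |cosResidual a b q m s (sin θ)| ≤ K * s ^ 2) ∧
      |(∫ x in fundDomain A, cosProfile q s (2 * π * ⟪w, x⟫_ℝ) *
        (cos (2 * π * ⟪w, x⟫_ℝ) * cosResidual a b q m s (sin (2 * π * ⟪w, x⟫_ℝ)))) -
        s ^ 2 * (|A.det| / 2 * (cosCoeff a b - m))| ≤ K * |s| ^ 3 * |A.det| := by
  obtain ⟨K, hK0, hK⟩ := exists_residual_bound (U₀ := fun _ => 1)
    (U₁ := fun x => 8 * q * x + a * x)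
    (U₂ := fun x => -(2 * a * q * (1 - 2 * x ^ 2))) (V₀ := fun _ => -1)
    (V₁ := fun x => -(2 * q * x)) (Φ₀ := fun x => 1 - x ^ 2)
    (Φ₁ := fun x => (1 - x ^ 2) * (2 * q * x))
    (by fun_prop) (by fun_prop) (by fun_prop) (by fun_prop) (by fun_prop) (by fun_prop)
    (by fun_prop) a b m (fun x => by ring)
    (fun x => by linear_combination 2 * x * hq) (fun x => rfl)
  refine ⟨K, hK0, fun s hs => ⟨fun θ => (hK s (sin θ) _ hs (abs_sin_le_one θ) rfl).1, ?_⟩⟩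
  have h := abs_setIntegral_sub_le hA (C := K * |s| ^ 3)
    (H := fun x => cosProfile q s (2 * π * ⟪w, x⟫_ℝ) *
      (cos (2 * π * ⟪w, x⟫_ℝ) * cosResidual a b q m s (sin (2 * π * ⟪w, x⟫_ℝ))))
    (G := fun x => s ^ 2 * ((-(2 * a * q) - m) +
      (2 * a * q + m + 12 * a * q + 3 * a ^ 2 / 2 - 2 * b * q - b ^ 2 / 2) *
        sin (2 * π * ⟪w, x⟫_ℝ) ^ 2 +
      (-(12 * a * q + 3 * a ^ 2 / 2 - 2 * b * q - b ^ 2 / 2)) * sin (2 * π * ⟪w, x⟫_ℝ) ^ 4))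
    (by
      have := continuous_cosResidual a b q m s
      unfold cosProfile
      fun_prop)
    (by fun_prop) (fun x => by
      have h1 := (hK s (sin (2 * π * ⟪w, x⟫_ℝ))
        (cosResidual a b q m s (sin (2 * π * ⟪w, x⟫_ℝ))) hs (abs_sin_le_one _) rfl).2
      convert! h1 using 2
      rw [cosProfile]
      linear_combination (1 + s * (2 * q * sin (2 * π * ⟪w, x⟫_ℝ))) *
        cosResidual a b q m s (sin (2 * π * ⟪w, x⟫_ℝ)) *
        (sin_sq_add_cos_sq (2 * π * ⟪w, x⟫_ℝ)))
  rw [integral_const_mul, setIntegral_even_quartic hA hw hw0] at h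
  convert! h using 3
  have : q = (b / 2 - a) / 3 := by linarith
  rw [cosCoeff, this]
  ring

end Residual

section Perturbation

variable {n : ℕ} {A : Matrix (Fin n) (Fin n) ℝ}

lemma hasDerivAt_sinProfile (q b s θ : ℝ) :
    HasDerivAt (sinProfile q b s) (cos θ * (1 + s * (4 * q * sin θ))) θ := by
  have h := (hasDerivAt_sin θ).add ((((((hasDerivAt_sin θ).pow 2).const_mul 2).const_sub
    1).const_mul q).neg.sub_const (b / 2) |>.const_mul s)
  convert! h using 1
  simp
  ring

lemma hasDerivAt_cosProfile (q s θ : ℝ) :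
    HasDerivAt (cosProfile q s) (-sin θ + s * (2 * q * (1 - 2 * sin θ ^ 2))) θ := by
  have h := (hasDerivAt_cos θ).mul ((((hasDerivAt_sin θ).const_mul (2 * q)).const_mul
    s).const_add 1)
  convert! h using 1
  linear_combination -2 * s * q * (sin_sq_add_cos_sq θ)

lemma continuous_sinProfile (q b s : ℝ) : Continuous (sinProfile q b s) := by
  unfold sinProfile
  fun_prop

lemma continuous_cosProfile (q s : ℝ) : Continuous (cosProfile q s) := by
  unfold cosProfile
  fun_prop

/-- The energy form near the plane spanned by the two approximate eigenfunctions. -/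
lemma energyForm_add_profile (hA : IsUnit A.det) {w : E n} (hw : w ∈ dualLattice (lattice A))
    (hw0 : w ≠ 0) {g : E n → ℝ} (hg : ContDiff ℝ 1 g) (hper : LatticePeriodic A g)
    (a b q m s α β : ℝ) :
    energyForm A w (a * s) (b * s) (4 * π ^ 2 * ‖w‖ ^ 2 * (1 + m * s ^ 2)) (fun x => g x +
      (α * sinProfile q b s (2 * π * ⟪w, x⟫_ℝ) + β * cosProfile q s (2 * π * ⟪w, x⟫_ℝ))) =
    energyForm A w (a * s) (b * s) (4 * π ^ 2 * ‖w‖ ^ 2 * (1 + m * s ^ 2)) g +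
    2 * (4 * π ^ 2 * ‖w‖ ^ 2) * (∫ x in fundDomain A, g x *
      (α * sinResidual a b q m s (sin (2 * π * ⟪w, x⟫_ℝ)) +
        β * (cos (2 * π * ⟪w, x⟫_ℝ) * cosResidual a b q m s (sin (2 * π * ⟪w, x⟫_ℝ))))) +
    4 * π ^ 2 * ‖w‖ ^ 2 * (α ^ 2 * (∫ x in fundDomain A, sinProfile q b s (2 * π * ⟪w, x⟫_ℝ) *
        sinResidual a b q m s (sin (2 * π * ⟪w, x⟫_ℝ))) +
      β ^ 2 * ∫ x in fundDomain A, cosProfile q s (2 * π * ⟪w, x⟫_ℝ) *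
        (cos (2 * π * ⟪w, x⟫_ℝ) * cosResidual a b q m s (sin (2 * π * ⟪w, x⟫_ℝ)))) := by
  have hS := continuous_sinResidual a b q m s
  have hC := continuous_cosResidual a b q m s
  have hSp := continuous_sinProfile q b s
  have hCp := continuous_cosProfile q s
  rw [energyForm_add_phase hA hw hg hper (F := fun θ => α * sinProfile q b s θ +
      β * cosProfile q s θ)
    (F' := fun θ => α * (cos θ * (1 + s * (4 * q * sin θ))) +
      β * (-sin θ + s * (2 * q * (1 - 2 * sin θ ^ 2))))
    (F'' := fun θ => α * (-sin θ + s * (4 * q * (1 - 2 * sin θ ^ 2))) +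
      β * (-cos θ - s * (8 * q * sin θ * cos θ)))
    (r := fun θ => α * sinResidual a b q m s (sin θ) +
      β * (cos θ * cosResidual a b q m s (sin θ)))
    (fun θ => ((hasDerivAt_sinProfile q b s θ).const_mul α).add
      ((hasDerivAt_cosProfile q s θ).const_mul β))
    (fun θ => by
      have h := (((hasDerivAt_cos θ).mul ((((hasDerivAt_sin θ).const_mul (4 * q)).const_mul
        s).const_add 1)).const_mul α).add (((hasDerivAt_sin θ).neg.add
        (((((hasDerivAt_sin θ).pow 2).const_mul 2).const_sub 1).const_mul (2 * q)
          |>.const_mul s)).const_mul β)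
      convert! h using 1
      simp
      linear_combination -4 * α * s * q * (sin_sq_add_cos_sq θ))
    (by unfold sinProfile cosProfile; fun_prop) (by fun_prop) (by fun_prop)
    (fun θ k => by simp only [sinProfile, cosProfile, sin_add_two_pi_int, cos_add_two_pi_int])
    (fun θ k => by simp only [sin_add_two_pi_int, cos_add_two_pi_int])
    (a * s) (b * s) (1 + m * s ^ 2)
    (fun θ => by
      simp only [sinProfile, cosProfile, sinResidual, cosResidual]
      linear_combination α * exp (a * s * sin θ) * (a * s * (1 + s * (4 * q * sin θ))) *
        (sin_sq_add_cos_sq θ))]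
  congr 2
  have h1 := setIntegral_cos_mul_comp_sin hA hw hw0 (ψ := fun x =>
    α * β * (x + s * (-(q * (1 - 2 * x ^ 2)) - b / 2)) * cosResidual a b q m s x +
    α * β * (1 + s * (2 * q * x)) * sinResidual a b q m s x) (by fun_prop)
  rw [← integral_const_mul, ← integral_const_mul, ← integral_add, ← add_zero (∫ x in _, _ + _),
    ← h1, ← integral_add]
  · refine integral_congr_ae (Eventually.of_forall fun x => ?_)
    simp only [sinProfile, cosProfile]
    ring
  all_goals
    refine integrableOn_fundDomain ?_
    fun_prop

lemma eventually_cosProfile_energy_nonpos (hA : IsUnit A.det) {w : E n}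
    (hw : w ∈ dualLattice (lattice A)) (hw0 : w ≠ 0) {a b q : ℝ} (hq : 3 * q = b / 2 - a)
    {ε : ℝ} (hε : 0 < ε) :
    ∀ᶠ s in 𝓝 (0:ℝ), energyForm A w (a * s) (b * s)
      (4 * π ^ 2 * ‖w‖ ^ 2 * (1 + (cosCoeff a b + ε) * s ^ 2))
      (fun x => cosProfile q s (2 * π * ⟪w, x⟫_ℝ)) ≤ 0 := by
  obtain ⟨K, hK0, hK⟩ := exists_cos_bound hA hw hw0 hq (cosCoeff a b + ε)
  have e1 : ∀ᶠ s in 𝓝 (0:ℝ), |s| < 1 :=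
    continuous_abs.continuousAt.eventually_lt continuousAt_const (by simp)
  have e2 : ∀ᶠ s in 𝓝 (0:ℝ), K * |s| < ε / 2 :=
    (continuous_const.mul continuous_abs).continuousAt.eventually_lt continuousAt_const
      (by simpa using by positivity)
  filter_upwards [e1, e2] with s hs1 hs2
  have h := energyForm_add_profile hA hw hw0 (g := fun _ => 0) contDiff_const
    (fun _ _ _ => rfl) a b q (cosCoeff a b + ε) s 0 1
  have h0 : ∀ x : E n, gradient (fun _ : E n => (0:ℝ)) x = 0 := fun x => gradient_const x 0
  have h2 : energyForm A w (a * s) (b * s)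
      (4 * π ^ 2 * ‖w‖ ^ 2 * (1 + (cosCoeff a b + ε) * s ^ 2)) (fun _ => 0) = 0 := by
    simp [energyForm, h0]
  simp only [zero_mul, zero_add, one_mul, h2, integral_zero, mul_zero, ne_eq, OfNat.ofNat_ne_zero,
    not_false_eq_true, zero_pow, one_pow] at h
  rw [h]
  have h3 := (abs_le.1 (hK s hs1.le).2).2
  refine mul_nonpos_of_nonneg_of_nonpos (by positivity) ?_
  have h4 : K * |s| ^ 3 * |A.det| ≤ ε / 2 * s ^ 2 * |A.det| := by
    have : K * |s| ^ 3 = K * |s| * s ^ 2 := by rw [← sq_abs s]; ring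
    rw [this]
    gcongr
  linarith

/-- A Poincaré inequality for the flat metric gives a lower bound for the weighted form. -/
lemma mul_setIntegral_sq_le_energyForm {w : E n} {a b Λ κ : ℝ} (hΛ : 0 ≤ Λ) {g : E n → ℝ}
    (hg : ContDiff ℝ 1 g)
    (h : κ * ∫ x in fundDomain A, g x ^ 2 ≤ ∫ x in fundDomain A, ‖gradient g x‖ ^ 2) :
    (exp (-|a|) * κ - Λ * exp |b|) * (∫ x in fundDomain A, g x ^ 2) ≤ energyForm A w a b Λ g := by
  have hgc := hg.continuous
  have hggc := continuous_gradient hg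
  have hab : ∀ c θ : ℝ, |c * sin θ| ≤ |c| := fun c θ => by
    rw [abs_mul]
    exact mul_le_of_le_one_right (abs_nonneg c) (abs_sin_le_one θ)
  have h1 : exp (-|a|) * (∫ x in fundDomain A, ‖gradient g x‖ ^ 2) ≤
      ∫ x in fundDomain A, ‖gradient g x‖ ^ 2 * exp (a * sin (2 * π * ⟪w, x⟫_ℝ)) := by
    rw [← integral_const_mul]
    refine integral_mono (integrableOn_fundDomain (by fun_prop))
      (integrableOn_fundDomain (by fun_prop)) fun x => ?_
    dsimp only
    rw [mul_comm]
    gcongr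
    exact (abs_le.1 (hab a _)).1
  have h2 : (∫ x in fundDomain A, g x ^ 2 * exp (b * sin (2 * π * ⟪w, x⟫_ℝ))) ≤
      exp |b| * ∫ x in fundDomain A, g x ^ 2 := by
    rw [← integral_const_mul]
    refine integral_mono (integrableOn_fundDomain (by fun_prop))
      (integrableOn_fundDomain (by fun_prop)) fun x => ?_
    dsimp only
    rw [mul_comm (exp |b|)]
    gcongr
    exact (abs_le.1 (hab b _)).2
  have h3 := mul_le_mul_of_nonneg_left h2 hΛ
  have h4 := mul_le_mul_of_nonneg_left h (exp_pos (-|a|)).le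
  unfold energyForm
  linarith

/-- Splitting off the constants and the two approximate eigenfunctions. -/
lemma exists_profile_decomposition (hA : IsUnit A.det) {w : E n}
    (hw : w ∈ dualLattice (lattice A)) (hw0 : w ≠ 0) (q b s : ℝ) {f : E n → ℝ}
    (hf : ContDiff ℝ 1 f) (hper : LatticePeriodic A f) :
    ∃ (k α β : ℝ) (g : E n → ℝ), ContDiff ℝ 1 g ∧ LatticePeriodic A g ∧
      (∫ x in fundDomain A, g x = 0) ∧
      (∫ x in fundDomain A, g x * sin (2 * π * ⟪w, x⟫_ℝ) = 0) ∧
      (∫ x in fundDomain A, g x * cos (2 * π * ⟪w, x⟫_ℝ) = 0) ∧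
      ∀ x, f x - k = g x + (α * sinProfile q b s (2 * π * ⟪w, x⟫_ℝ) +
        β * cosProfile q s (2 * π * ⟪w, x⟫_ℝ)) := by
  have hD : |A.det| ≠ 0 := (abs_pos.2 hA.ne_zero).ne'
  have hfc := hf.continuous
  have hSp := continuous_sinProfile q b s
  have hCp := continuous_cosProfile q s
  have hc0 := setIntegral_cos_mul_comp_sin hA hw hw0 (ψ := fun x => 1 + s * (2 * q * x))
    (by fun_prop)
  have hc1 := setIntegral_cos_mul_comp_sin hA hw hw0 (ψ := fun x => (1 + s * (2 * q * x)) * x)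
    (by fun_prop)
  have hc2 := setIntegral_cos_mul_comp_sin hA hw hw0
    (ψ := fun x => x + s * (-(q * (1 - 2 * x ^ 2)) - b / 2)) (by fun_prop)
  have hsin := setIntegral_sin hA hw hw0
  have hcos := setIntegral_cos_mul_comp_sin hA hw hw0 (ψ := fun _ => 1) (by fun_prop)
  have hsin2 := setIntegral_sin_sq hA hw hw0
  have hsin3 := setIntegral_sin_pow_three hA hw hw0
  have hone := setIntegral_one hA
  have i1 : ∫ x in fundDomain A, sinProfile q b s (2 * π * ⟪w, x⟫_ℝ) * sin (2 * π * ⟪w, x⟫_ℝ) =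
      |A.det| / 2 := by
    rw [← hsin2, ← add_zero (∫ x in _, sin _ ^ 2), ← mul_zero (s * (-q - b / 2)), ← hsin,
      ← add_zero (_ + _), ← mul_zero (s * (2 * q)), ← hsin3, ← integral_const_mul,
      ← integral_const_mul, ← integral_add, ← integral_add]
    · refine integral_congr_ae (Eventually.of_forall fun x => ?_)
      simp only [sinProfile]
      ring
    all_goals
      refine integrableOn_fundDomain ?_
      fun_prop
  have i2 : ∫ x in fundDomain A, sinProfile q b s (2 * π * ⟪w, x⟫_ℝ) * cos (2 * π * ⟪w, x⟫_ℝ) =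
      0 := by
    rw [← hc2]
    refine integral_congr_ae (Eventually.of_forall fun x => ?_)
    simp only [sinProfile]
    ring
  have j0 : ∫ x in fundDomain A, cosProfile q s (2 * π * ⟪w, x⟫_ℝ) = 0 := hc0
  have j1 : ∫ x in fundDomain A, cosProfile q s (2 * π * ⟪w, x⟫_ℝ) * sin (2 * π * ⟪w, x⟫_ℝ) =
      0 := by
    rw [← hc1]
    refine integral_congr_ae (Eventually.of_forall fun x => ?_)
    simp only [cosProfile]
    ring
  have j2 : ∫ x in fundDomain A, cosProfile q s (2 * π * ⟪w, x⟫_ℝ) * cos (2 * π * ⟪w, x⟫_ℝ) =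
      |A.det| / 2 := by
    suffices h : ∫ x in fundDomain A, cosProfile q s (2 * π * ⟪w, x⟫_ℝ) *
        cos (2 * π * ⟪w, x⟫_ℝ) = (∫ x in fundDomain A, (1:ℝ)) -
          (∫ x in fundDomain A, sin (2 * π * ⟪w, x⟫_ℝ) ^ 2) +
          s * (2 * q) * (∫ x in fundDomain A, sin (2 * π * ⟪w, x⟫_ℝ)) -
          s * (2 * q) * ∫ x in fundDomain A, sin (2 * π * ⟪w, x⟫_ℝ) ^ 3 by
      rw [h, hone, hsin2, hsin, hsin3]
      ring
    rw [← integral_const_mul, ← integral_const_mul, ← integral_sub, ← integral_add,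
      ← integral_sub]
    · refine integral_congr_ae (Eventually.of_forall fun x => ?_)
      simp only [cosProfile]
      linear_combination (1 + s * (2 * q * sin (2 * π * ⟪w, x⟫_ℝ))) *
        sin_sq_add_cos_sq (2 * π * ⟪w, x⟫_ℝ)
    all_goals
      refine integrableOn_fundDomain ?_
      fun_prop
  set α := 2 * (∫ x in fundDomain A, f x * sin (2 * π * ⟪w, x⟫_ℝ)) / |A.det| with hα
  set β := 2 * (∫ x in fundDomain A, f x * cos (2 * π * ⟪w, x⟫_ℝ)) / |A.det| with hβ
  set k := ((∫ x in fundDomain A, f x) -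
    α * ∫ x in fundDomain A, sinProfile q b s (2 * π * ⟪w, x⟫_ℝ)) / |A.det| with hk
  have hmul : ∀ u : E n → ℝ, Continuous u →
      ∫ x in fundDomain A, (f x - k - (α * sinProfile q b s (2 * π * ⟪w, x⟫_ℝ) +
        β * cosProfile q s (2 * π * ⟪w, x⟫_ℝ))) * u x =
      (∫ x in fundDomain A, f x * u x) - k * (∫ x in fundDomain A, u x) -
        (α * (∫ x in fundDomain A, sinProfile q b s (2 * π * ⟪w, x⟫_ℝ) * u x) +
          β * ∫ x in fundDomain A, cosProfile q s (2 * π * ⟪w, x⟫_ℝ) * u x) := by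
    intro u hu
    rw [← integral_const_mul, ← integral_const_mul, ← integral_const_mul, ← integral_add,
      ← integral_sub, ← integral_sub]
    · refine integral_congr_ae (Eventually.of_forall fun x => ?_)
      ring
    all_goals
      refine integrableOn_fundDomain ?_
      fun_prop
  refine ⟨k, α, β, fun x => f x - k - (α * sinProfile q b s (2 * π * ⟪w, x⟫_ℝ) +
    β * cosProfile q s (2 * π * ⟪w, x⟫_ℝ)), ?_, ?_, ?_, ?_, ?_, fun x => by ring⟩
  · have hF : ContDiff ℝ 1 fun θ => α * sinProfile q b s θ + β * cosProfile q s θ := by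
      unfold sinProfile cosProfile
      fun_prop
    exact (hf.sub contDiff_const).sub (hF.comp (contDiff_phase w))
  · intro x γ hγ
    have := latticePeriodic_inner_comp hw
      (G := fun θ => α * sinProfile q b s θ + β * cosProfile q s θ) (fun θ k => by
        simp only [sinProfile, cosProfile, sin_add_two_pi_int, cos_add_two_pi_int]) x γ hγ
    simp only [hper x γ hγ, this]
  · have h := hmul (fun _ => 1) continuous_const
    simp only [mul_one] at h
    rw [h, hone, j0, hk]
    field_simp
    ring
  · rw [hmul _ (by fun_prop), hsin, i1, j1, hα]
    field_simp
    ring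
  · simp only [mul_one] at hcos
    rw [hmul _ (by fun_prop), hcos, i2, j2, hβ]
    field_simp
    ring

lemma eventually_energy_nonneg (hA : IsUnit A.det) {w : E n}
    (hgap : GapCondition (lattice A) w) {a b q : ℝ} (hq : 3 * q = b / 2 - a)
    (hab : cosCoeff a b ≤ sinCoeff a b) {ε : ℝ} (hε : 0 < ε) :
    ∀ᶠ s in 𝓝 (0:ℝ), ∀ f : E n → ℝ, ContDiff ℝ 1 f → LatticePeriodic A f →
      ∫ x in fundDomain A, f x * exp (b * s * sin (2 * π * ⟪w, x⟫_ℝ)) = 0 →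
      0 ≤ energyForm A w (a * s) (b * s)
        (4 * π ^ 2 * ‖w‖ ^ 2 * (1 + (cosCoeff a b - ε) * s ^ 2)) f := by
  have hw := hgap.1
  have hw0 := hgap.2.1
  set m := cosCoeff a b - ε with hm
  set L := 4 * π ^ 2 * ‖w‖ ^ 2 with hL
  have hLpos : 0 < L := by
    have := norm_pos_iff.2 hw0
    have := pi_pos
    positivity
  have hD : 0 < |A.det| := abs_pos.2 hA.ne_zero
  obtain ⟨κ, hκ, hpoin⟩ := exists_poincare hA hgap
  obtain ⟨K₁, hK₁0, hK₁⟩ := exists_sin_bound hA hw hw0 hq m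
  obtain ⟨K₂, hK₂0, hK₂⟩ := exists_cos_bound hA hw hw0 hq m
  set K := K₁ + K₂ with hK
  have hK0 : 0 ≤ K := add_nonneg hK₁0 hK₂0
  set δ := (κ - L) / 2 with hδ
  have hδ0 : 0 < δ := by rw [hδ]; linarith
  have e1 : ∀ᶠ s in 𝓝 (0:ℝ), |s| < 1 :=
    continuous_abs.continuousAt.eventually_lt continuousAt_const (by simp)
  have e2 : ∀ᶠ s in 𝓝 (0:ℝ), (K + 2 * (L / δ) * K ^ 2) * |s| < ε / 2 :=
    (continuous_const.mul continuous_abs).continuousAt.eventually_lt continuousAt_const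
      (by simpa using by positivity)
  have e3 : ∀ᶠ s in 𝓝 (0:ℝ), 0 < 1 + m * s ^ 2 :=
    ContinuousAt.eventually_lt (g := fun s : ℝ => 1 + m * s ^ 2) continuousAt_const
      (by fun_prop) (by simp)
  have e4 : ∀ᶠ s in 𝓝 (0:ℝ),
      δ < exp (-|a * s|) * κ - L * (1 + m * s ^ 2) * exp |b * s| :=
    ContinuousAt.eventually_lt
      (g := fun s : ℝ => exp (-|a * s|) * κ - L * (1 + m * s ^ 2) * exp |b * s|)
      continuousAt_const (by fun_prop) (by simp; linarith)
  filter_upwards [e1, e2, e3, e4] with s hs1 hs2 hs3 hs4 f hf hper hmean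
  have hΛ : 0 ≤ L * (1 + m * s ^ 2) := by positivity
  obtain ⟨k, α, β, g, hg, hgper, hg0, hgs, hgc, hdec⟩ :=
    exists_profile_decomposition hA hw hw0 q b s hf hper
  refine le_trans ?_ (energyForm_sub_const_le hΛ hf hmean k)
  rw [funext hdec, energyForm_add_profile hA hw hw0 hg hgper a b q m s α β]
  have hQg := mul_setIntegral_sq_le_energyForm (w := w) (a := a * s) (b := b * s) hΛ hg
    (hpoin g hg hgper hg0 hgs hgc)
  have hg2 : 0 ≤ ∫ x in fundDomain A, g x ^ 2 := integral_nonneg fun x => sq_nonneg _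
  have hQg' := (mul_le_mul_of_nonneg_right hs4.le hg2).trans hQg
  have hgcont := hg.continuous
  have hS := continuous_sinResidual a b q m s
  have hC := continuous_cosResidual a b q m s
  set r : E n → ℝ := fun x => α * sinResidual a b q m s (sin (2 * π * ⟪w, x⟫_ℝ)) +
    β * (cos (2 * π * ⟪w, x⟫_ℝ) * cosResidual a b q m s (sin (2 * π * ⟪w, x⟫_ℝ))) with hr
  have hrc : Continuous r := by fun_prop
  have hrsq : ∀ x, r x ^ 2 ≤ 2 * (α ^ 2 + β ^ 2) * (K * s ^ 2) ^ 2 := by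
    intro x
    have b1 : sinResidual a b q m s (sin (2 * π * ⟪w, x⟫_ℝ)) ^ 2 ≤ (K * s ^ 2) ^ 2 :=
      sq_le_sq' (abs_le.1 (((hK₁ s hs1.le).1 _).trans (by gcongr; linarith))).1
        (abs_le.1 (((hK₁ s hs1.le).1 _).trans (by gcongr; linarith))).2
    have b2 : cosResidual a b q m s (sin (2 * π * ⟪w, x⟫_ℝ)) ^ 2 ≤ (K * s ^ 2) ^ 2 :=
      sq_le_sq' (abs_le.1 (((hK₂ s hs1.le).1 _).trans (by gcongr; linarith))).1
        (abs_le.1 (((hK₂ s hs1.le).1 _).trans (by gcongr; linarith))).2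
    have b3 : (cos (2 * π * ⟪w, x⟫_ℝ) * cosResidual a b q m s (sin (2 * π * ⟪w, x⟫_ℝ))) ^ 2 ≤
        (K * s ^ 2) ^ 2 := by
      rw [mul_pow]
      refine le_trans (mul_le_of_le_one_left (sq_nonneg _) ?_) b2
      exact cos_sq_le_one _
    calc r x ^ 2 ≤ 2 * ((α * sinResidual a b q m s (sin (2 * π * ⟪w, x⟫_ℝ))) ^ 2 +
          (β * (cos (2 * π * ⟪w, x⟫_ℝ) *
            cosResidual a b q m s (sin (2 * π * ⟪w, x⟫_ℝ)))) ^ 2) := add_sq_le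
      _ = 2 * (α ^ 2 * sinResidual a b q m s (sin (2 * π * ⟪w, x⟫_ℝ)) ^ 2 +
          β ^ 2 * (cos (2 * π * ⟪w, x⟫_ℝ) *
            cosResidual a b q m s (sin (2 * π * ⟪w, x⟫_ℝ))) ^ 2) := by ring
      _ ≤ 2 * (α ^ 2 * (K * s ^ 2) ^ 2 + β ^ 2 * (K * s ^ 2) ^ 2) := by gcongr
      _ = 2 * (α ^ 2 + β ^ 2) * (K * s ^ 2) ^ 2 := by ring
  have hcross : -(L ^ 2 / δ * (2 * (α ^ 2 + β ^ 2) * (K * s ^ 2) ^ 2) * |A.det|) ≤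
      δ * (∫ x in fundDomain A, g x ^ 2) + 2 * L * ∫ x in fundDomain A, g x * r x := by
    have hone : ∫ x in fundDomain A, -(L ^ 2 / δ * (2 * (α ^ 2 + β ^ 2) * (K * s ^ 2) ^ 2)) =
        -(L ^ 2 / δ * (2 * (α ^ 2 + β ^ 2) * (K * s ^ 2) ^ 2) * |A.det|) := by
      rw [← setIntegral_one hA, ← integral_const_mul, ← integral_neg]
      simp
    rw [← hone, ← integral_const_mul, ← integral_const_mul, ← integral_add]
    · refine integral_mono (integrableOn_fundDomain (by fun_prop))
        (integrableOn_fundDomain (by fun_prop)) fun x => ?_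
      dsimp only
      have c1 := mul_le_mul_of_nonneg_left (hrsq x) (show 0 ≤ L ^ 2 / δ by positivity)
      have c2 : δ * g x ^ 2 + 2 * L * (g x * r x) + L ^ 2 / δ * r x ^ 2 =
          (δ * g x + L * r x) ^ 2 / δ := by
        field_simp
        ring
      have c3 : 0 ≤ (δ * g x + L * r x) ^ 2 / δ := by positivity
      linarith
    all_goals
      refine integrableOn_fundDomain ?_
      fun_prop
  have hs2' : s ^ 2 ≤ |s| := by
    rw [← sq_abs]
    nlinarith [abs_nonneg s]
  have hcube : ∀ Ki, Ki ≤ K → Ki * |s| ^ 3 * |A.det| ≤ K * |s| * s ^ 2 * |A.det| := by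
    intro Ki hKi
    have : K * |s| * s ^ 2 = K * |s| ^ 3 := by rw [← sq_abs s]; ring
    rw [this]
    gcongr
  have hI : ∀ {I c Ki : ℝ}, cosCoeff a b ≤ c → Ki ≤ K →
      |I - s ^ 2 * (|A.det| / 2 * (c - m))| ≤ Ki * |s| ^ 3 * |A.det| →
      (ε / 2 - K * |s|) * (s ^ 2 * |A.det|) ≤ I := by
    intro I c Ki hc hKi h
    have h1 := (abs_le.1 h).1
    have h2 := hcube Ki hKi
    have h3 : s ^ 2 * (|A.det| / 2 * ε) ≤ s ^ 2 * (|A.det| / 2 * (c - m)) := by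
      gcongr
      linarith
    linarith
  have hI₁ := hI hab (by linarith) (hK₁ s hs1.le).2
  have hI₂ := hI le_rfl (by linarith) (hK₂ s hs1.le).2
  have hI₁' := mul_le_mul_of_nonneg_left hI₁ (sq_nonneg α)
  have hI₂' := mul_le_mul_of_nonneg_left hI₂ (sq_nonneg β)
  have hfin : L ^ 2 / δ * (2 * (α ^ 2 + β ^ 2) * (K * s ^ 2) ^ 2) * |A.det| ≤
      L * ((α ^ 2 + β ^ 2) * ((ε / 2 - K * |s|) * (s ^ 2 * |A.det|))) := by
    have h1 : 2 * (L / δ) * K ^ 2 * s ^ 2 ≤ ε / 2 - K * |s| := by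
      have : 2 * (L / δ) * K ^ 2 * s ^ 2 ≤ 2 * (L / δ) * K ^ 2 * |s| := by gcongr
      linarith
    calc L ^ 2 / δ * (2 * (α ^ 2 + β ^ 2) * (K * s ^ 2) ^ 2) * |A.det| =
        L * ((α ^ 2 + β ^ 2) * ((2 * (L / δ) * K ^ 2 * s ^ 2) * (s ^ 2 * |A.det|))) := by ring
      _ ≤ _ := by gcongr
  have hLI := mul_le_mul_of_nonneg_left (add_le_add hI₁' hI₂') hLpos.le
  linarith

/-- The first eigenvalue in terms of the weighted energy form, for `s = t √2 / √D`. -/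
lemma confLam1_uSin_eq (A : Matrix (Fin n) (Fin n) ℝ) (w : E n) (t : ℝ) :
    confLam1 A (uSin A w) t = sInf {r : ℝ | ∃ f : E n → ℝ, ContDiff ℝ (⊤ : ℕ∞) f ∧
      LatticePeriodic A f ∧ f ≠ 0 ∧
      (∫ x in fundDomain A, f x *
        exp ((n : ℝ) / 2 * (t * (√2 / √|A.det|)) * sin (2 * π * ⟪w, x⟫_ℝ))) = 0 ∧
      r = (∫ x in fundDomain A, ‖gradient f x‖ ^ 2 *
          exp (((n : ℝ) - 2) / 2 * (t * (√2 / √|A.det|)) * sin (2 * π * ⟪w, x⟫_ℝ))) /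
        ∫ x in fundDomain A, f x ^ 2 *
          exp ((n : ℝ) / 2 * (t * (√2 / √|A.det|)) * sin (2 * π * ⟪w, x⟫_ℝ))} := by
  have h1 : ∀ x, (n : ℝ) * t * uSin A w x / 2 =
      (n : ℝ) / 2 * (t * (√2 / √|A.det|)) * sin (2 * π * ⟪w, x⟫_ℝ) := fun x => by
    rw [uSin]
    ring
  have h2 : ∀ x, ((n : ℝ) - 2) * t * uSin A w x / 2 =
      ((n : ℝ) - 2) / 2 * (t * (√2 / √|A.det|)) * sin (2 * π * ⟪w, x⟫_ℝ) := fun x => by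
    rw [uSin]
    ring
  simp only [confLam1, h1, h2]
  rfl

lemma setIntegral_sq_mul_exp_pos (hA : IsUnit A.det) {w : E n}
    (hw : w ∈ dualLattice (lattice A)) {f : E n → ℝ} (hf : Continuous f)
    (hper : LatticePeriodic A f) (hf0 : f ≠ 0) (b : ℝ) :
    0 < ∫ x in fundDomain A, f x ^ 2 * exp (b * sin (2 * π * ⟪w, x⟫_ℝ)) := by
  obtain ⟨x, hx⟩ := Function.ne_iff.1 hf0
  refine LatticePeriodic.setIntegral_pos hA
    (h := fun x => f x ^ 2 * exp (b * sin (2 * π * ⟪w, x⟫_ℝ))) ?_ (by fun_prop)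
    (fun x => by positivity) (x := x) (mul_ne_zero (pow_ne_zero 2 hx) (exp_ne_zero _))
  intro x γ hγ
  have h := latticePeriodic_inner_comp hw (G := sin) sin_add_two_pi_int x γ hγ
  simp only [hper x γ hγ, h]

/-- Two-sided bounds for the infimum of the weighted Rayleigh quotients. -/
lemma eventually_abs_sInf_sub_le (hA : IsUnit A.det) {w : E n}
    (hgap : GapCondition (lattice A) w) {a b : ℝ} (hab : cosCoeff a b ≤ sinCoeff a b)
    {ε : ℝ} (hε : 0 < ε) :
    ∀ᶠ s in 𝓝 (0:ℝ), |sInf {r : ℝ | ∃ f : E n → ℝ, ContDiff ℝ (⊤ : ℕ∞) f ∧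
      LatticePeriodic A f ∧ f ≠ 0 ∧
      (∫ x in fundDomain A, f x * exp (b * s * sin (2 * π * ⟪w, x⟫_ℝ))) = 0 ∧
      r = (∫ x in fundDomain A, ‖gradient f x‖ ^ 2 *
          exp (a * s * sin (2 * π * ⟪w, x⟫_ℝ))) /
        ∫ x in fundDomain A, f x ^ 2 * exp (b * s * sin (2 * π * ⟪w, x⟫_ℝ))} -
      4 * π ^ 2 * ‖w‖ ^ 2 * (1 + cosCoeff a b * s ^ 2)| ≤
      4 * π ^ 2 * ‖w‖ ^ 2 * (ε * s ^ 2) := by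
  have hw := hgap.1
  have hw0 := hgap.2.1
  obtain ⟨q, hq⟩ : ∃ q : ℝ, 3 * q = b / 2 - a := ⟨(b / 2 - a) / 3, by ring⟩
  filter_upwards [eventually_cosProfile_energy_nonpos hA hw hw0 hq hε,
    eventually_energy_nonneg hA hgap hq hab hε] with s hup hlow
  set S := {r : ℝ | ∃ f : E n → ℝ, ContDiff ℝ (⊤ : ℕ∞) f ∧
      LatticePeriodic A f ∧ f ≠ 0 ∧
      (∫ x in fundDomain A, f x * exp (b * s * sin (2 * π * ⟪w, x⟫_ℝ))) = 0 ∧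
      r = (∫ x in fundDomain A, ‖gradient f x‖ ^ 2 *
          exp (a * s * sin (2 * π * ⟪w, x⟫_ℝ))) /
        ∫ x in fundDomain A, f x ^ 2 * exp (b * s * sin (2 * π * ⟪w, x⟫_ℝ))} with hS
  let f₀ : E n → ℝ := fun x => cosProfile q s (2 * π * ⟪w, x⟫_ℝ)
  have hf₀ : ContDiff ℝ (⊤ : ℕ∞) f₀ := by
    have h1 : ContDiff ℝ (⊤ : ℕ∞) (cosProfile q s) := by
      unfold cosProfile
      fun_prop
    exact h1.comp (contDiff_const.mul (contDiff_const.inner ℝ contDiff_id))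
  have hp₀ : LatticePeriodic A f₀ := latticePeriodic_inner_comp hw fun θ k => by
    simp only [cosProfile, sin_add_two_pi_int, cos_add_two_pi_int]
  have hf₀0 : f₀ ≠ 0 := fun h => by
    have := congrFun h 0
    simp [f₀, cosProfile] at this
  have hm₀ : ∫ x in fundDomain A, f₀ x * exp (b * s * sin (2 * π * ⟪w, x⟫_ℝ)) = 0 := by
    rw [← setIntegral_cos_mul_comp_sin hA hw hw0
      (ψ := fun x => (1 + s * (2 * q * x)) * exp (b * s * x)) (by fun_prop)]
    refine integral_congr_ae (Eventually.of_forall fun x => ?_)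
    simp only [f₀, cosProfile]
    ring
  have hlb : ∀ r ∈ S, 4 * π ^ 2 * ‖w‖ ^ 2 * (1 + (cosCoeff a b - ε) * s ^ 2) ≤ r := by
    rintro r ⟨f, hf, hper, hf0, hmean, rfl⟩
    have hpos := setIntegral_sq_mul_exp_pos hA hw hf.continuous hper hf0 (b * s)
    rw [le_div_iff₀ hpos]
    exact sub_nonneg.1 (hlow f (hf.of_le (by exact_mod_cast le_top)) hper hmean)
  have hmem : (∫ x in fundDomain A, ‖gradient f₀ x‖ ^ 2 *
      exp (a * s * sin (2 * π * ⟪w, x⟫_ℝ))) /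
        ∫ x in fundDomain A, f₀ x ^ 2 * exp (b * s * sin (2 * π * ⟪w, x⟫_ℝ)) ∈ S :=
    ⟨f₀, hf₀, hp₀, hf₀0, hm₀, rfl⟩
  have h1 : 4 * π ^ 2 * ‖w‖ ^ 2 * (1 + (cosCoeff a b - ε) * s ^ 2) ≤ sInf S :=
    le_csInf ⟨_, hmem⟩ hlb
  have h2 : sInf S ≤ 4 * π ^ 2 * ‖w‖ ^ 2 * (1 + (cosCoeff a b + ε) * s ^ 2) := by
    refine (csInf_le ⟨_, hlb⟩ hmem).trans ?_
    rw [div_le_iff₀ (setIntegral_sq_mul_exp_pos hA hw hf₀.continuous hp₀ hf₀0 (b * s))]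
    exact sub_nonpos.1 hup
  rw [abs_le]
  constructor <;> linarith

end Perturbation

/-- Second-order Taylor expansion of `λ₁(t)` for the conformal deformation with `φ = u₁`:
`λ₁(t) = λ₁ + (λ₁·(n² − 5n + 1)/(12D))·t² + o(t²)` as `t → 0`. -/
theorem statement8 (n : ℕ) (hn : 2 ≤ n) (A : Matrix (Fin n) (Fin n) ℝ) (hA : IsUnit A.det)
    (w : E n) (hgap : GapCondition (lattice A) w)
    (lam₁ : ℝ) (hlam₁ : lam₁ = 4 * π ^ 2 * ‖w‖ ^ 2)
    (φ : E n → ℝ) (hφ : φ = uSin A w) :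
    (fun t : ℝ => confLam1 A φ t
        - (lam₁ + lam₁ * ((n : ℝ) ^ 2 - 5 * (n : ℝ) + 1) / (12 * |A.det|) * t ^ 2))
      =o[𝓝 (0 : ℝ)] fun t => t ^ 2 := by
  subst hlam₁ hφ
  have hD : 0 < |A.det| := abs_pos.2 hA.ne_zero
  have hL : 0 < 4 * π ^ 2 * ‖w‖ ^ 2 := by
    have := norm_pos_iff.2 hgap.2.1
    have := pi_pos
    positivity
  have hcoeff : cosCoeff (((n : ℝ) - 2) / 2) ((n : ℝ) / 2) ≤
      sinCoeff (((n : ℝ) - 2) / 2) ((n : ℝ) / 2) := by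
    have : (2 : ℝ) ≤ n := by exact_mod_cast hn
    unfold cosCoeff sinCoeff
    linarith
  rw [isLittleO_iff]
  intro c hc
  have hε : 0 < c * |A.det| / (2 * (4 * π ^ 2 * ‖w‖ ^ 2)) := by positivity
  have htend : Tendsto (fun t : ℝ => t * (√2 / √|A.det|)) (𝓝 0) (𝓝 0) := by
    simpa using (continuous_mul_const (√2 / √|A.det|)).tendsto 0
  filter_upwards [htend.eventually (eventually_abs_sInf_sub_le hA hgap hcoeff hε)] with t ht
  rw [← confLam1_uSin_eq] at ht
  have hs : (t * (√2 / √|A.det|)) ^ 2 = t ^ 2 * (2 / |A.det|) := by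
    rw [mul_pow, div_pow, sq_sqrt zero_le_two, sq_sqrt hD.le]
  rw [hs] at ht
  rw [Real.norm_eq_abs, norm_pow, Real.norm_eq_abs, sq_abs]
  convert! ht using 1
  · congr 2
    rw [cosCoeff]
    field_simp
    ring
  · have hw := norm_ne_zero_iff.2 hgap.2.1
    field_simp
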